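/- arXiv:1001.4249 — 3 statements merged into one kernel-verified Lean document; each statement's English description precedes it below -/
import Mathlib

section
/- For every r ≥ 2 and ε > 0 there exists δ > 0 such that for all sufficiently large n: log₂ |P_n(K_{r+1}(⌊δ log n⌋; ⌈n^{1-√δ}⌉))| lies between (1 - 1/r)·C(n,2) and (1 - 1/r + ε)·C(n,2), where P_n(H) is the set of labelled graphs on [n] containing no copy of H as a subgraph. -/
open SimpleGraph

/-- `H` is contained in `G` as a (not necessarily induced) subgraph. -/
def Contains {α β : Type*} (H : SimpleGraph α) (G : SimpleGraph β) : Prop :=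
  ∃ f : H →g G, Function.Injective f

/-- The complete (r+1)-partite graph with r parts of size p and one part of size q. -/
def Kparts (r p q : ℕ) : SimpleGraph (Σ i : Fin (r+1), Fin (if (i:ℕ) < r then p else q)) :=
  SimpleGraph.completeMultipartiteGraph fun i : Fin (r+1) => Fin (if (i:ℕ) < r then p else q)

/-- **Counting lemma** for cliques: if between any two of the sets `U i` all large subsets span
density at least `d`, then a positive proportion of the transversals of `U` are cliques. -/
theorem exists_le_card_transversal_cliques (k : ℕ) {d : ℝ} (hd : 0 < d) :
    ∃ α : ℝ, 0 < α ∧ ∃ β : ℝ, 0 < β ∧ ∀ (V : Type) [Fintype V] [DecidableEq V]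
      (G : SimpleGraph V) [DecidableRel G.Adj] (U : Fin k → Finset V),
      (∀ i j, i ≠ j → ∀ X ⊆ U i, ∀ Y ⊆ U j, α * (U i).card ≤ X.card → α * (U j).card ≤ Y.card →
        d * X.card * Y.card ≤ (G.interedges X Y).card) →
      β * ∏ i, ((U i).card : ℝ) ≤
        ((Finset.univ.filter fun m : Fin k → V =>
          (∀ i, m i ∈ U i) ∧ ∀ i j, i ≠ j → G.Adj (m i) (m j)).card : ℝ) := by
  induction k with
  | zero =>
    refine ⟨1, one_pos, 1, one_pos, fun V _ _ G _ U _ => ?_⟩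
    simp
  | succ k ih =>
    obtain ⟨α, hα, β, hβ, ih⟩ := ih
    refine ⟨min (d * α) (1 / (2 * (k + 1))), by positivity, β * d ^ k / 2, by positivity,
      fun V _ _ G _ U hU => ?_⟩
    set α' := min (d * α) (1 / (2 * (k + 1) : ℝ)) with hα'
    have hα'pos : 0 < α' := by positivity
    have hα'1 : α' ≤ d * α := min_le_left _ _
    have hα'2 : α' * (2 * (k + 1)) ≤ 1 := by
      have := min_le_right (d * α) (1 / (2 * (k + 1) : ℝ))
      rwa [← hα', le_div_iff₀ (by positivity)] at this
    have hα'3 : α' ≤ 1 := by nlinarith [(Nat.cast_nonneg k : (0:ℝ) ≤ k)]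
    rcases Nat.eq_zero_or_pos (U 0).card with h0 | h0
    · rw [Fin.prod_univ_succ, h0]; simp
    have h0' : (0 : ℝ) < (U 0).card := by exact_mod_cast h0
    let N : Fin k → V → Finset V := fun j v => (U j.succ).filter (G.Adj v)
    let bad : Fin k → Finset V := fun j =>
      (U 0).filter fun v => ((N j v).card : ℝ) < d * (U j.succ).card
    have hbad : ∀ j, ((bad j).card : ℝ) ≤ α' * (U 0).card := by
      intro j
      by_contra! hlt
      have hne : (bad j).Nonempty := by
        rw [← Finset.card_pos]
        have : (0 : ℝ) < (bad j).card := lt_trans (by positivity) hlt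
        exact_mod_cast this
      have h1 := hU 0 j.succ (Fin.succ_ne_zero j).symm (bad j) (Finset.filter_subset _ _)
        (U j.succ) subset_rfl hlt.le (by nlinarith [(Nat.cast_nonneg (U j.succ).card : (0:ℝ) ≤ _)])
      have h2 : ((G.interedges (bad j) (U j.succ)).card : ℝ) = ∑ v ∈ bad j, ((N j v).card : ℝ) := by
        rw [interedges, Rel.interedges, Finset.card_filter, Finset.sum_product]
        push_cast
        refine Finset.sum_congr rfl fun v _ => ?_
        rw [Finset.card_filter]
        push_cast
        rfl
      have h3 : ∑ v ∈ bad j, ((N j v).card : ℝ) < ∑ v ∈ bad j, d * ((U j.succ).card : ℝ) :=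
        Finset.sum_lt_sum_of_nonempty hne fun v hv => (Finset.mem_filter.1 hv).2
      rw [Finset.sum_const, nsmul_eq_mul] at h3
      nlinarith
    let good : Finset V := U 0 \ Finset.univ.biUnion bad
    have hgood : ((U 0).card : ℝ) / 2 ≤ good.card := by
      have h1 : (U 0).card ≤ good.card + (Finset.univ.biUnion bad).card := by
        have := Finset.le_card_sdiff (Finset.univ.biUnion bad) (U 0)
        simp only [good]; omega
      have h2 : ((Finset.univ.biUnion bad).card : ℝ) ≤ k * (α' * (U 0).card) := by
        calc ((Finset.univ.biUnion bad).card : ℝ) ≤ ∑ j, ((bad j).card : ℝ) := by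
              exact_mod_cast Finset.card_biUnion_le
          _ ≤ ∑ j : Fin k, α' * (U 0).card := Finset.sum_le_sum fun j _ => hbad j
          _ = _ := by simp
      have h3 : ((U 0).card : ℝ) ≤ good.card + (Finset.univ.biUnion bad).card := by
        exact_mod_cast h1
      have h4 : k * (α' * (U 0).card) ≤ ((U 0).card : ℝ) / 2 := by nlinarith
      linarith
    have hN : ∀ v ∈ good, ∀ j, d * (U j.succ).card ≤ ((N j v).card : ℝ) := by
      intro v hv j
      by_contra! hlt
      simp only [good, Finset.mem_sdiff, Finset.mem_biUnion, Finset.mem_univ, true_and,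
        not_exists] at hv
      exact hv.2 j (Finset.mem_filter.2 ⟨hv.1, hlt⟩)
    have hcount : ∀ v ∈ good, β * d ^ k * ∏ j : Fin k, ((U j.succ).card : ℝ) ≤
        ((Finset.univ.filter fun m : Fin k → V =>
          (∀ i, m i ∈ N i v) ∧ ∀ i j, i ≠ j → G.Adj (m i) (m j)).card : ℝ) := by
      intro v hv
      refine le_trans ?_ (ih V G (fun j => N j v) ?_)
      · rw [mul_assoc]
        gcongr
        calc d ^ k * ∏ j : Fin k, ((U j.succ).card : ℝ) = ∏ j : Fin k, d * ((U j.succ).card : ℝ) := by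
              simp [Finset.prod_mul_distrib]
          _ ≤ _ := Finset.prod_le_prod (fun _ _ => by positivity) fun j _ => hN v hv j
      · have aux : ∀ (i : Fin k) (X : Finset V), α * (N i v).card ≤ X.card →
            α' * (U i.succ).card ≤ X.card := by
          intro i X h
          have := hN v hv i
          nlinarith [(Nat.cast_nonneg (U i.succ).card : (0:ℝ) ≤ _)]
        intro i j hij X hX Y hY hXc hYc
        exact hU i.succ j.succ (by simpa using hij) X (hX.trans (Finset.filter_subset _ _)) Y
          (hY.trans (Finset.filter_subset _ _)) (aux i X hXc) (aux j Y hYc)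
    have hinj : (good.sigma fun v => Finset.univ.filter fun m : Fin k → V =>
          (∀ i, m i ∈ N i v) ∧ ∀ i j, i ≠ j → G.Adj (m i) (m j)).card ≤
        (Finset.univ.filter fun m : Fin (k + 1) → V =>
          (∀ i, m i ∈ U i) ∧ ∀ i j, i ≠ j → G.Adj (m i) (m j)).card := by
      refine Finset.card_le_card_of_injOn (fun p => Fin.cons p.1 p.2) ?_ ?_
      · rintro ⟨v, m⟩ hm
        simp only [Finset.coe_sigma, Set.mem_sigma_iff, Finset.mem_coe, Finset.mem_filter,
          Finset.mem_univ, true_and, N] at hm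
        obtain ⟨hv, hm1, hm2⟩ := hm
        simp only [Finset.coe_filter, Finset.mem_univ, true_and, Set.mem_ofPred_eq]
        refine ⟨fun i => ?_, fun i j hij => ?_⟩
        · cases i using Fin.cases with
          | zero => exact (Finset.mem_sdiff.1 hv).1
          | succ i => exact (hm1 i).1
        · cases i using Fin.cases with
          | zero =>
            cases j using Fin.cases with
            | zero => exact absurd rfl hij
            | succ j => exact (hm1 j).2
          | succ i =>
            cases j using Fin.cases with
            | zero => exact (hm1 i).2.symm
            | succ j => exact hm2 i j (by simpa using hij)
      · rintro ⟨v, m⟩ _ ⟨v', m'⟩ _ h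
        obtain ⟨h1, h2⟩ := Fin.cons_inj.1 h
        subst h1 h2
        rfl
    refine le_trans ?_ (Nat.cast_le.2 hinj)
    rw [Finset.card_sigma, Fin.prod_univ_succ]
    push_cast
    have hsum := Finset.sum_le_sum hcount
    rw [Finset.sum_const, nsmul_eq_mul] at hsum
    refine le_trans ?_ hsum
    have hprod : 0 ≤ β * d ^ k * ∏ j : Fin k, ((U j.succ).card : ℝ) :=
      mul_nonneg (mul_nonneg hβ.le (pow_nonneg hd.le k))
        (Finset.prod_nonneg fun _ _ => Nat.cast_nonneg _)
    have hmul := mul_le_mul_of_nonneg_right hgood hprod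
    linarith

/-- A dense family of `(k + 1)`-cliques contains a logarithmic number of disjoint `k`-cliques, any
two of which are completely joined across different coordinates, that can all be extended within
the family by each vertex of a common large set. -/
theorem exists_joined_cliques (k : ℕ) {c : ℝ} (hc : 0 < c) :
    ∃ K : ℕ, 0 < K ∧ ∀ (V : Type) [Fintype V] [DecidableEq V] (G : SimpleGraph V)
      (M : Finset (Fin (k + 1) → V)),
      (∀ m ∈ M, ∀ i j, i ≠ j → G.Adj (m i) (m j)) →
      c * (Fintype.card V : ℝ) ^ (k + 1) ≤ M.card →
      ∀ s t : ℕ, 1 ≤ s → 1 ≤ t → K * t * 2 ^ (K * s) ≤ Fintype.card V →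
      ∃ (x : Fin s → Fin k → V) (T : Finset V), t ≤ T.card ∧
        (∀ i, ∀ y ∈ T, (Fin.snoc (x i) y : Fin (k + 1) → V) ∈ M) ∧
        (∀ a, Function.Injective fun i => x i a) ∧
        ∀ a b, a ≠ b → ∀ i j, G.Adj (x i a) (x j b) := by
  induction k generalizing c with
  | zero =>
    obtain ⟨K, hK⟩ := exists_nat_gt (1 / c)
    have hK0 : 0 < K := by
      have : (0 : ℝ) < K := lt_trans (by positivity) hK
      exact_mod_cast this
    refine ⟨K, hK0, fun V _ _ G M _ hM s t hs ht hn => ?_⟩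
    refine ⟨fun _ => Fin.elim0, M.image fun m => m 0, ?_, ?_, fun a => a.elim0, fun a => a.elim0⟩
    · rw [Finset.card_image_of_injective]
      · have h1 : K * t ≤ Fintype.card V :=
          le_trans (Nat.le_mul_of_pos_right _ (by positivity)) hn
        have h2 : (K : ℝ) * t ≤ Fintype.card V := by exact_mod_cast h1
        have h3 : 1 ≤ c * K := by
          rw [div_lt_iff₀ hc] at hK
          linarith
        have h4 : (t : ℝ) ≤ M.card := by
          refine le_trans ?_ hM
          rw [zero_add, pow_one]
          nlinarith [(Nat.cast_nonneg t : (0 : ℝ) ≤ t)]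
        exact_mod_cast h4
      · intro m m' h
        funext i
        rw [Subsingleton.elim (α := Fin 1) i 0]
        exact h
    · intro i y hy
      obtain ⟨m, hm, rfl⟩ := Finset.mem_image.1 hy
      convert hm using 1
      funext j
      rw [show j = Fin.last 0 from Subsingleton.elim (α := Fin 1) _ _, Fin.snoc_last]
      rfl
  | succ k ih =>
    obtain ⟨K', hK'0, ih⟩ := ih (c := c / 2) (by positivity)
    obtain ⟨L, hL⟩ := exists_nat_gt (4 / c)
    have hLr : (0 : ℝ) < L := lt_trans (by positivity) hL
    have hL0 : 0 < L := by exact_mod_cast hLr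
    have hcL : 4 < c * L := by
      rw [div_lt_iff₀ hc] at hL
      linarith
    refine ⟨K' * L + L + 1, by positivity, fun V _ _ G M hG hM s t hs ht hn => ?_⟩
    set n := Fintype.card V with hndef
    have hn1 : 1 ≤ n := le_trans (Nat.one_le_iff_ne_zero.2 (by positivity)) hn
    have hnr : (0 : ℝ) < n := by exact_mod_cast hn1
    let ext : (Fin (k + 1) → V) → Finset V := fun m =>
      Finset.univ.filter fun y => (Fin.snoc m y : Fin (k + 2) → V) ∈ M
    let M' : Finset (Fin (k + 1) → V) :=
      Finset.univ.filter fun m => c / 2 * n ≤ ((ext m).card : ℝ)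
    have hsum : (M.card : ℝ) = ∑ m : Fin (k + 1) → V, ((ext m).card : ℝ) := by
      rw [← Nat.cast_sum, ← Finset.card_sigma]
      congr 1
      refine Finset.card_bij' (fun m _ => ⟨Fin.init m, m (Fin.last _)⟩)
        (fun p _ => (Fin.snoc p.1 p.2 : Fin (k + 2) → V)) ?_ ?_ ?_ ?_
      · intro m hm
        simp [ext, hm]
      · rintro ⟨m, y⟩ hm
        simpa [ext] using hm
      · intro m hm
        simp
      · rintro ⟨m, y⟩ hm
        simp
    have hM' : c / 2 * (n : ℝ) ^ (k + 1) ≤ M'.card := by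
      have h1 : ∀ m : Fin (k + 1) → V, ((ext m).card : ℝ) ≤
          (if c / 2 * n ≤ ((ext m).card : ℝ) then (n : ℝ) else 0) + c / 2 * n := by
        intro m
        have h2 : ((ext m).card : ℝ) ≤ n := by exact_mod_cast Finset.card_le_univ _
        split_ifs with h
        · have : 0 ≤ c / 2 * n := by positivity
          linarith
        · linarith
      have h2 := Finset.sum_le_sum fun m (_ : m ∈ Finset.univ) => h1 m
      rw [← hsum, Finset.sum_add_distrib, ← Finset.sum_filter, Finset.sum_const, Finset.sum_const,
        nsmul_eq_mul, nsmul_eq_mul, Finset.card_univ, Fintype.card_fun, Fintype.card_fin] at h2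
      push_cast at h2
      rw [← hndef] at h2
      have h3 := hM.trans h2
      have h4 : c * (n : ℝ) ^ (k + 1 + 1) = c / 2 * n ^ (k + 1) * n + n ^ (k + 1) * (c / 2 * n) := by
        ring
      rw [h4] at h3
      exact le_of_mul_le_mul_right (by simpa [M'] using le_of_add_le_add_right h3) hnr
    have hG' : ∀ m ∈ M', ∀ i j, i ≠ j → G.Adj (m i) (m j) := by
      intro m hm i j hij
      have h1 : 0 < ((ext m).card : ℝ) := lt_of_lt_of_le (by positivity) (Finset.mem_filter.1 hm).2
      obtain ⟨y, hy⟩ := Finset.card_pos.1 (Nat.cast_pos.1 h1)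
      have := hG _ (Finset.mem_filter.1 hy).2 i.castSucc j.castSucc (by simpa using hij)
      simpa using this
    have hn2 : K' * (L * s) * 2 ^ (K' * (L * s)) ≤ n := by
      refine le_trans ?_ hn
      calc K' * (L * s) * 2 ^ (K' * (L * s)) ≤ K' * (L * 2 ^ s) * 2 ^ (K' * (L * s)) := by
            gcongr; exact Nat.lt_two_pow_self.le
        _ = K' * L * 1 * 2 ^ (s + K' * (L * s)) := by rw [pow_add]; ring
        _ ≤ (K' * L + L + 1) * t * 2 ^ ((K' * L + L + 1) * s) := by
            gcongr
            · omega
            · omega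
            · nlinarith
    obtain ⟨x', T', hT', hx'M, hx'inj, hx'adj⟩ :=
      ih V G M' hG' hM' (L * s) (L * s) (Nat.mul_pos hL0 hs) (Nat.mul_pos hL0 hs) hn2
    obtain ⟨y', hy'⟩ : ∃ y' : Fin (L * s) ↪ V, ∀ i, y' i ∈ T' := by
      have : Nonempty (Fin (L * s) ↪ T') := by
        apply Function.Embedding.nonempty_of_card_le
        simpa using hT'
      obtain ⟨e⟩ := this
      exact ⟨e.trans (Function.Embedding.subtype _), fun i => (e i).2⟩
    let z : Fin (L * s) → Fin (k + 1) → V := fun i => Fin.snoc (x' i) (y' i)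
    have hz : ∀ i, z i ∈ M' := fun i => hx'M i _ (hy' i)
    have hzinj : ∀ a, Function.Injective fun i => z i a := by
      intro a
      cases a using Fin.lastCases with
      | last => simpa [z] using y'.injective
      | cast a => simpa [z] using hx'inj a
    have hzadj : ∀ a b, a ≠ b → ∀ i j, G.Adj (z i a) (z j b) := by
      intro a b hab i j
      cases a using Fin.lastCases with
      | last =>
        cases b using Fin.lastCases with
        | last => exact absurd rfl hab
        | cast b =>
          have := hG' _ (hx'M j _ (hy' i)) b.castSucc (Fin.last _) (by simp)
          simpa [z] using this.symm
      | cast a =>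
        cases b using Fin.lastCases with
        | last =>
          have := hG' _ (hx'M i _ (hy' j)) a.castSucc (Fin.last _) (by simp)
          simpa [z] using this
        | cast b => simpa [z] using hx'adj a b (by simpa using hab) i j
    let S : V → Finset (Fin (L * s)) := fun y => Finset.univ.filter fun i => y ∈ ext (z i)
    let Y : Finset V := Finset.univ.filter fun y => s ≤ (S y).card
    have hY : c / 4 * n ≤ Y.card := by
      have hsr : (0 : ℝ) < s := by exact_mod_cast hs
      have h1 : ∑ y, ((S y).card : ℝ) = ∑ i, ((ext (z i)).card : ℝ) := by
        simp only [S, Finset.card_filter, Nat.cast_sum]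
        rw [Finset.sum_comm]
        refine Finset.sum_congr rfl fun i _ => ?_
        rw [← Nat.cast_sum, ← Finset.card_filter]
        simp
      have h2 : (L * s : ℝ) * (c / 2 * n) ≤ ∑ i, ((ext (z i)).card : ℝ) := by
        have := Finset.sum_le_sum fun i (_ : i ∈ (Finset.univ : Finset (Fin (L * s)))) =>
          (Finset.mem_filter.1 (hz i)).2
        simpa using this
      have h3 : ∀ y, ((S y).card : ℝ) ≤ (if s ≤ (S y).card then (L * s : ℝ) else 0) + s := by
        intro y
        have h2 : (S y).card ≤ L * s := by simpa using Finset.card_le_univ (S y)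
        have h2' : ((S y).card : ℝ) ≤ L * s := by exact_mod_cast h2
        split_ifs with h
        · linarith
        · have : ((S y).card : ℝ) < s := by exact_mod_cast not_le.1 h
          linarith
      have h4 := Finset.sum_le_sum fun y (_ : y ∈ Finset.univ) => h3 y
      rw [h1, Finset.sum_add_distrib, ← Finset.sum_filter, Finset.sum_const, Finset.sum_const,
        nsmul_eq_mul, nsmul_eq_mul, Finset.card_univ, ← hndef] at h4
      have h5 : (L * s : ℝ) * (c / 2 * n) ≤ Y.card * (L * s) + n * s := h2.trans h4
      have h6 : (n : ℝ) * s ≤ L * s * (c / 4 * n) := by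
        have : 0 < (n : ℝ) * s := by positivity
        nlinarith
      have h7 : c / 4 * n * (L * s : ℝ) ≤ Y.card * (L * s) := by linarith
      exact le_of_mul_le_mul_right h7 (by positivity)
    obtain ⟨I, hI⟩ : ∃ I : Finset (Fin (L * s)), t ≤ (Y.filter fun y => S y = I).card := by
      by_contra! hlt
      have h1 : Y.card = ∑ I : Finset (Fin (L * s)), (Y.filter fun y => S y = I).card :=
        Finset.card_eq_sum_card_fiberwise fun y _ => by simp
      have h2 : Y.card < 2 ^ (L * s) * t := by
        rw [h1]
        calc _ < ∑ I : Finset (Fin (L * s)), t :=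
              Finset.sum_lt_sum_of_nonempty Finset.univ_nonempty fun I _ => hlt I
          _ = _ := by simp
      have h3 : L * (2 ^ (L * s) * t) ≤ n := by
        refine le_trans ?_ hn
        calc L * (2 ^ (L * s) * t) = L * t * 2 ^ (L * s) := by ring
          _ ≤ (K' * L + L + 1) * t * 2 ^ ((K' * L + L + 1) * s) := by
            gcongr
            · omega
            · norm_num
            · nlinarith
      have h4 : (L : ℝ) * (2 ^ (L * s) * t) ≤ n := by exact_mod_cast h3
      have h5 : (Y.card : ℝ) < 2 ^ (L * s) * t := by exact_mod_cast h2
      nlinarith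
    have hIs : s ≤ I.card := by
      obtain ⟨y, hy⟩ := Finset.card_pos.1 (lt_of_lt_of_le ht hI)
      obtain ⟨hy1, rfl⟩ := Finset.mem_filter.1 hy
      exact (Finset.mem_filter.1 hy1).2
    obtain ⟨e, he⟩ : ∃ e : Fin s ↪ Fin (L * s), ∀ i, e i ∈ I := by
      have : Nonempty (Fin s ↪ I) := by
        apply Function.Embedding.nonempty_of_card_le
        simpa using hIs
      obtain ⟨e⟩ := this
      exact ⟨e.trans (Function.Embedding.subtype _), fun i => (e i).2⟩
    refine ⟨fun i => z (e i), Y.filter fun y => S y = I, hI, ?_,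
      fun a => (hzinj a).comp e.injective, fun a b hab i j => hzadj a b hab _ _⟩
    intro i y hy
    have h1 : e i ∈ S y := by rw [(Finset.mem_filter.1 hy).2]; exact he i
    have h2 : y ∈ ext (z (e i)) := (Finset.mem_filter.1 h1).2
    exact (Finset.mem_filter.1 h2).2

/-- A bound on the number of subsets of `S` of size at most `m`, with a free parameter `x`. -/
theorem card_powerset_filter_card_le_mul_pow {α : Type*} (S : Finset α) {x : ℝ} (hx : 0 ≤ x)
    (hx1 : x ≤ 1) (m : ℕ) :
    ((S.powerset.filter fun B => B.card ≤ m).card : ℝ) * x ^ m ≤ (1 + x) ^ S.card := by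
  have h := Finset.sum_pow_mul_eq_add_pow x 1 S
  simp only [one_pow, mul_one] at h
  rw [add_comm 1 x, ← h, ← nsmul_eq_mul, ← Finset.sum_const]
  calc ∑ B ∈ S.powerset.filter (fun B => B.card ≤ m), x ^ m
      ≤ ∑ B ∈ S.powerset.filter (fun B => B.card ≤ m), x ^ B.card :=
        Finset.sum_le_sum fun B hB => pow_le_pow_of_le_one hx hx1 (Finset.mem_filter.1 hB).2
    _ ≤ _ := Finset.sum_le_sum_of_subset_of_nonneg (Finset.filter_subset _ _)
        fun _ _ _ => by positivity

/-- If every graph in a family is contained, up to at most `m` edges, in one of the graphs `C i`,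
each having at most `e` edges, then the family is small. -/
theorem card_mul_pow_le_of_containers {V ι : Type*} [Fintype V] [DecidableEq V] [Fintype ι]
    (C : ι → SimpleGraph V) (P : SimpleGraph V → Prop) (e m : ℕ) {x : ℝ} (hx : 0 ≤ x)
    (hx1 : x ≤ 1)
    (hP : ∀ G, P G → ∃ i, (C i).edgeSet.ncard ≤ e ∧ (G \ C i).edgeSet.ncard ≤ m) :
    (Nat.card {G : SimpleGraph V // P G} : ℝ) * x ^ m ≤
      Fintype.card ι * 2 ^ e * (1 + x) ^ ((Fintype.card V).choose 2) := by
  classical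
  let S : Finset (Sym2 V) := (⊤ : SimpleGraph V).edgeFinset
  let small := S.powerset.filter fun B => B.card ≤ m
  let D : Finset (Σ _ : ι, Finset (Sym2 V) × Finset (Sym2 V)) :=
    (Finset.univ.filter fun i => (C i).edgeFinset.card ≤ e).sigma
      fun i => (C i).edgeFinset.powerset ×ˢ small
  have key : Nat.card {G : SimpleGraph V // P G} ≤ D.card := by
    rw [← Nat.card_eq_finsetCard D]
    choose c hc1 hc2 using hP
    refine Nat.card_le_card_of_injective (fun G => ⟨⟨c G.1 G.2,
      ((G.1 ⊓ C (c G.1 G.2)).edgeFinset, (G.1 \ C (c G.1 G.2)).edgeFinset)⟩, ?_⟩) ?_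
    · have h1 := hc1 G.1 G.2
      have h2 := hc2 G.1 G.2
      rw [← coe_edgeFinset, Set.ncard_coe_finset] at h1 h2
      simp only [D, small, S, Finset.mem_sigma, Finset.mem_filter, Finset.mem_univ, true_and,
        Finset.mem_product, Finset.mem_powerset]
      exact ⟨h1, edgeFinset_mono inf_le_right, edgeFinset_mono le_top, h2⟩
    · rintro ⟨G, hG⟩ ⟨G', hG'⟩ h
      simp only [Subtype.mk.injEq, Sigma.mk.injEq, heq_eq_eq, Prod.mk.injEq, edgeFinset_inj] at h
      obtain ⟨h0, h1, h2⟩ := h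
      rw [h0] at h1 h2
      ext a b
      have h1' := congrArg (fun H => H.Adj a b) h1
      have h2' := congrArg (fun H => H.Adj a b) h2
      simp only [inf_adj, sdiff_adj, eq_iff_iff] at h1' h2'
      tauto
  have hD : (D.card : ℝ) ≤ Fintype.card ι * (2 ^ e * small.card) := by
    have : D.card ≤ Fintype.card ι * (2 ^ e * small.card) := by
      rw [Finset.card_sigma]
      refine (Finset.sum_le_card_nsmul _ _ (2 ^ e * small.card) fun i hi => ?_).trans ?_
      · rw [Finset.card_product, Finset.card_powerset]
        gcongr
        · norm_num
        · exact (Finset.mem_filter.1 hi).2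
      · rw [smul_eq_mul]
        gcongr
        exact Finset.card_le_univ _
    exact_mod_cast this
  have hsmall := card_powerset_filter_card_le_mul_pow S hx hx1 m
  rw [show S.card = (Fintype.card V).choose 2 from card_edgeFinset_top_eq_card_choose_two] at hsmall
  calc (Nat.card {G : SimpleGraph V // P G} : ℝ) * x ^ m ≤ D.card * x ^ m := by gcongr
    _ ≤ Fintype.card ι * (2 ^ e * small.card) * x ^ m := by gcongr
    _ = Fintype.card ι * 2 ^ e * (small.card * x ^ m) := by ring
    _ ≤ _ := by gcongr

/-- A graph with `e` edges has at least `2 ^ e` subgraphs. -/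
theorem two_pow_card_edgeFinset_le_card_subgraphs {V : Type*} [Fintype V] [DecidableEq V]
    (T : SimpleGraph V) [DecidableRel T.Adj] (P : SimpleGraph V → Prop) (hP : ∀ G ≤ T, P G) :
    2 ^ T.edgeFinset.card ≤ Nat.card {G : SimpleGraph V // P G} := by
  classical
  rw [← Finset.card_powerset, ← Nat.card_eq_finsetCard]
  have hT : ∀ E : T.edgeFinset.powerset, ((E : Finset (Sym2 V)) : Set (Sym2 V)) ⊆ T.edgeSet := by
    rintro ⟨E, hE⟩
    simpa [← Finset.coe_subset] using hE
  refine Nat.card_le_card_of_injective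
    (fun E => ⟨fromEdgeSet (E : Finset (Sym2 V)), hP _ ?_⟩) ?_
  · rw [← edgeSet_subset_edgeSet, edgeSet_fromEdgeSet]
    exact Set.sdiff_subset.trans (hT E)
  · intro E E' h
    have h1 : ∀ E : T.edgeFinset.powerset,
        (fromEdgeSet ((E : Finset (Sym2 V)) : Set (Sym2 V))).edgeSet = (E : Finset (Sym2 V)) := by
      intro E
      rw [edgeSet_fromEdgeSet, sdiff_eq_left, Set.disjoint_left]
      intro e he hd
      exact T.not_isDiag_of_mem_edgeSet (hT E he) hd
    have h2 := congrArg edgeSet (Subtype.mk.inj h)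
    rw [h1, h1] at h2
    exact Subtype.ext (Finset.coe_injective h2)

/-- The Turán graph has at least a `1 - 1 / r` proportion of all edges. -/
theorem le_card_edgeFinset_turanGraph {n r : ℕ} (hr : 0 < r) :
    (1 - 1 / (r : ℝ)) * (n.choose 2 : ℝ) ≤ (turanGraph n r).edgeFinset.card := by
  have hr0 : (0 : ℝ) < r := by exact_mod_cast hr
  have hr1 : (0 : ℝ) ≤ 1 - 1 / r := by
    rw [sub_nonneg, div_le_one hr0]
    exact_mod_cast hr
  have hr2 : 1 - 1 / (r : ℝ) ≤ 1 := by
    have : 0 ≤ 1 / (r : ℝ) := by positivity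
    linarith
  induction n using Nat.strong_induction_on with
  | _ n ih =>
    rcases lt_or_ge n r with h | h
    · have h1 : (turanGraph n r).edgeFinset.card = n.choose 2 := by
        have := card_edgeFinset_top_eq_card_choose_two (V := Fin n)
        rw [Fintype.card_fin] at this
        convert! this
        rw [turanGraph_eq_top]
        exact .inr h.le
      rw [h1]
      exact mul_le_of_le_one_left (Nat.cast_nonneg _) hr2
    · obtain ⟨m, rfl⟩ := Nat.exists_eq_add_of_le' h
      have ih := ih m (by omega)
      rw [card_edgeFinset_turanGraph_add]
      push_cast [Nat.cast_sub hr, Nat.cast_choose_two] at ih ⊢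
      have h1 : (0 : ℝ) ≤ r * (r - 1) / 2 := by
        have : (1 : ℝ) ≤ r := by exact_mod_cast hr
        have : (0 : ℝ) ≤ r - 1 := by linarith
        positivity
      have h2 : (1 - 1 / (r : ℝ)) * ((m + r) * (m + r - 1) / 2) =
          (1 - 1 / (r : ℝ)) * (m * (m - 1) / 2) + m * (r - 1) +
            (1 - 1 / (r : ℝ)) * (r * (r - 1) / 2) := by
        field_simp
        ring
      rw [h2]
      have := mul_le_of_le_one_left h1 hr2
      linarith

/-- A clique-free graph has at most the Turán proportion of edges. -/
theorem ncard_edgeSet_le_of_cliqueFree {n r : ℕ} (hr : 0 < r) (C : SimpleGraph (Fin n))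
    (hC : C.CliqueFree (r + 1)) :
    (C.edgeSet.ncard : ℝ) ≤ (1 - 1 / (r : ℝ)) * (n : ℝ) ^ 2 / 2 := by
  classical
  rw [← coe_edgeFinset, Set.ncard_coe_finset]
  have h := (isTuranMaximal_turanGraph (n := n) hr).2 hC
  have h2 := mul_card_edgeFinset_turanGraph_le (n := n) (r := r)
  have h3 : 2 * r * C.edgeFinset.card ≤ (r - 1) * n ^ 2 := le_trans (by gcongr) h2
  have h4 : (2 * r * C.edgeFinset.card : ℝ) ≤ (r - 1) * n ^ 2 := by
    have := (Nat.cast_le (α := ℝ)).2 h3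
    push_cast [Nat.cast_sub hr] at this
    simpa using this
  have hr0 : (0 : ℝ) < r := by exact_mod_cast hr
  have h5 : (1 - 1 / (r : ℝ)) * (n : ℝ) ^ 2 / 2 = (r - 1) * n ^ 2 / (2 * r) := by field_simp
  rw [h5, le_div_iff₀ (by positivity)]
  linarith

theorem two_mul_ncard_edgeSet_le_card {V : Type*} [Fintype V] (G : SimpleGraph V)
    (S : Finset (V × V)) (h : ∀ x y, G.Adj x y → (x, y) ∈ S) : 2 * G.edgeSet.ncard ≤ S.card := by
  classical
  rw [← coe_edgeFinset, Set.ncard_coe_finset, two_mul_card_edgeFinset]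
  exact Finset.card_le_card fun z hz => h z.1 z.2 (Finset.mem_filter.1 hz).2

theorem card_div_le_card_of_mem_parts {V : Type*} [Fintype V] [DecidableEq V]
    {P : Finpartition (Finset.univ : Finset V)} (hP : P.IsEquipartition) {M : ℕ}
    (hM : P.parts.card ≤ M) {U : Finset V} (hU : U ∈ P.parts) :
    (Fintype.card V : ℝ) / (2 * M) ≤ U.card := by
  have hpos : 0 < P.parts.card := Finset.card_pos.2 ⟨U, hU⟩
  have h1 : Fintype.card V / P.parts.card ≤ U.card := by
    simpa using hP.average_le_card_part hU
  have h2 : Fintype.card V ≤ 2 * P.parts.card * U.card := by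
    have h3 : P.parts.card ≤ Fintype.card V := by simpa using P.card_parts_le_card
    have h4 := Nat.div_add_mod (Fintype.card V) P.parts.card
    have h5 := Nat.mod_lt (Fintype.card V) hpos
    have h6 : 1 ≤ Fintype.card V / P.parts.card := (Nat.one_le_div_iff hpos).2 h3
    nlinarith
  have h7 : Fintype.card V ≤ 2 * M * U.card := h2.trans (by gcongr)
  have hM0 : (0 : ℝ) < M := by exact_mod_cast hpos.trans_le hM
  rw [div_le_iff₀ (by positivity)]
  have : (Fintype.card V : ℝ) ≤ 2 * M * U.card := by exact_mod_cast h7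
  linarith

/-- By the regularity lemma, either `G` has many cliques of size `r + 1`, or almost all its edges
lie in a blow-up, free of such cliques, of a graph of bounded size. -/
theorem exists_many_cliques_or_container (r : ℕ) {η : ℝ} (hη : 0 < η) :
    ∃ c : ℝ, 0 < c ∧ ∃ M N : ℕ, 0 < M ∧ ∀ n ≥ N, ∀ (G : SimpleGraph (Fin n)) [DecidableRel G.Adj],
      c * (n : ℝ) ^ (r + 1) ≤ ((Finset.univ.filter fun m : Fin (r + 1) → Fin n =>
          ∀ i j, i ≠ j → G.Adj (m i) (m j)).card : ℝ) ∨
      ∃ (f : Fin n → Fin M) (R : SimpleGraph (Fin M)), (R.comap f).CliqueFree (r + 1) ∧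
        ((G \ R.comap f).edgeSet.ncard : ℝ) ≤ η * (n : ℝ) ^ 2 := by
  obtain ⟨α, hα, β, hβ, hcount⟩ :=
    exists_le_card_transversal_cliques (r + 1) (show 0 < η / 16 by positivity)
  set ε := min α (η / 16) with hε
  have hεpos : 0 < ε := by positivity
  have hεα : ε ≤ α := min_le_left _ _
  have hεη : ε ≤ η / 16 := min_le_right _ _
  set l := ⌈4 / η⌉₊
  set M := SzemerediRegularity.bound ε l
  have hM0 : 0 < M := SzemerediRegularity.bound_pos _ _
  have hM0' : (0 : ℝ) < M := by exact_mod_cast hM0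
  refine ⟨β * (1 / (2 * M)) ^ (r + 1), by positivity, M, max l 1, hM0, fun n hn G _ => ?_⟩
  have hnl : l ≤ Fintype.card (Fin n) := by simpa using (le_max_left l 1).trans hn
  have hn1 : 1 ≤ n := (le_max_right l 1).trans hn
  obtain ⟨P, hP, hlP, hPM, hPu⟩ := szemeredi_regularity G hεpos hnl
  let p : Fin n → P.parts := fun v => ⟨P.part v, P.part_mem.2 (Finset.mem_univ v)⟩
  have hp : ∀ v, v ∈ (p v : Finset (Fin n)) := fun v => P.mem_part (Finset.mem_univ v)
  let H : SimpleGraph P.parts :=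
    { Adj := fun U W => U ≠ W ∧ G.IsUniform ε U.1 W.1 ∧ η / 8 ≤ (G.edgeDensity U.1 W.1 : ℝ)
      symm := ⟨fun U W h => ⟨h.1.symm, h.2.1.symm, by rw [edgeDensity_comm]; exact h.2.2⟩⟩
      loopless := ⟨fun U h => h.1 rfl⟩ }
  by_cases hcf : (H.comap p).CliqueFree (r + 1)
  · right
    obtain ⟨e⟩ : Nonempty (P.parts ↪ Fin M) := by
      apply Function.Embedding.nonempty_of_card_le
      simpa using hPM
    have hcomap : (H.map e).comap (e ∘ p) = H.comap p := by
      rw [← comap_comap, comap_map_eq]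
    refine ⟨e ∘ p, H.map e, ?_⟩
    rw [hcomap]
    refine ⟨hcf, ?_⟩
    classical
    have : Nonempty (Fin n) := ⟨⟨0, hn1⟩⟩
    let B₁ := (P.nonUniforms G ε).biUnion fun (U, W) ↦ U ×ˢ W
    let B₂ := P.parts.biUnion Finset.offDiag
    let B₃ := (P.sparsePairs G (η / 8)).biUnion fun (U, W) ↦ G.interedges U W
    have hsub : ∀ x y, (G \ H.comap p).Adj x y → (x, y) ∈ B₁ ∪ B₂ ∪ B₃ := by
      intro x y hxy
      rw [sdiff_adj, comap_adj] at hxy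
      obtain ⟨hxy, hnot⟩ := hxy
      simp only [B₁, B₂, B₃, Finset.mem_union, Finset.mem_biUnion, Prod.exists,
        P.mk_mem_nonUniforms, P.mk_mem_sparsePairs, Finset.mem_product, Finset.mem_offDiag,
        mem_interedges_iff]
      rcases eq_or_ne (p x) (p y) with h | h
      · exact Or.inl (Or.inr ⟨p x, (p x).2, hp x, h ▸ hp y, hxy.ne⟩)
      have h' : (p x : Finset (Fin n)) ≠ p y := fun h0 => h (Subtype.ext h0)
      by_cases hu : G.IsUniform ε (p x).1 (p y).1
      · refine Or.inr ⟨p x, p y, ⟨(p x).2, (p y).2, h', ?_⟩, hp x, hp y, hxy⟩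
        by_contra! hd
        exact hnot ⟨h, hu, hd⟩
      · exact Or.inl (Or.inl ⟨p x, p y, ⟨(p x).2, (p y).2, h', hu⟩, hp x, hp y⟩)
    have h1 : (B₁.card : ℝ) ≤ 4 * ε * (n : ℝ) ^ 2 := by
      simpa using (hP.sum_nonUniforms_lt Finset.univ_nonempty hεpos hPu).le
    have h2 : (B₂.card : ℝ) ≤ η / 2 * (n : ℝ) ^ 2 := by
      simpa using hP.card_biUnion_offDiag_le hη ((Nat.le_ceil _).trans (Nat.cast_le.2 hlP))
    have h3 : (B₃.card : ℝ) ≤ 4 * (η / 8) * (n : ℝ) ^ 2 := by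
      simpa using hP.card_interedges_sparsePairs_le (G := G) (ε := η / 8) (by positivity)
    have h4 : 2 * (G \ H.comap p).edgeSet.ncard ≤ B₁.card + B₂.card + B₃.card := by
      refine (two_mul_ncard_edgeSet_le_card _ _ hsub).trans ((Finset.card_union_le _ _).trans ?_)
      gcongr
      exact Finset.card_union_le _ _
    have h5 : 2 * ((G \ H.comap p).edgeSet.ncard : ℝ) ≤ B₁.card + B₂.card + B₃.card := by
      exact_mod_cast h4
    have h6 : ε * (n : ℝ) ^ 2 ≤ η / 16 * (n : ℝ) ^ 2 := by gcongr
    have h7 : 0 ≤ η * (n : ℝ) ^ 2 := by positivity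
    linarith
  · left
    obtain ⟨φ⟩ := (not_cliqueFree_iff_top_isContained _).1 hcf
    have hφ : ∀ i j, i ≠ j → H.Adj (p (φ i)) (p (φ j)) := fun i j hij =>
      φ.toHom.map_adj hij
    have hcnt := hcount (Fin n) G (fun i => (p (φ i)).1) (by
      intro i j hij X hX Y hY hXc hYc
      obtain ⟨-, hu, hd⟩ := hφ i j hij
      have h1 := hu hX hY (by nlinarith [(Nat.cast_nonneg (p (φ i)).1.card : (0 : ℝ) ≤ _)])
        (by nlinarith [(Nat.cast_nonneg (p (φ j)).1.card : (0 : ℝ) ≤ _)])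
      have h2 : η / 16 ≤ (G.edgeDensity X Y : ℝ) := by
        have := (abs_lt.1 h1).1
        linarith
      rcases (Nat.cast_nonneg (X.card * Y.card) : (0 : ℝ) ≤ _).eq_or_lt with h0 | h0
      · rw [mul_assoc, ← Nat.cast_mul, ← h0, mul_zero]
        positivity
      · rw [edgeDensity_def] at h2
        push_cast at h0 h2
        rw [le_div_iff₀ h0] at h2
        linarith)
    refine le_trans ?_ (hcnt.trans (Nat.cast_le.2 (Finset.card_le_card ?_)))
    · rw [mul_assoc, ← mul_pow]
      refine mul_le_mul_of_nonneg_left ?_ hβ.le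
      calc (1 / (2 * M) * (n : ℝ)) ^ (r + 1) = ∏ i : Fin (r + 1), (1 / (2 * M) * (n : ℝ)) := by simp
        _ ≤ ∏ i, ((p (φ i)).1.card : ℝ) := by
          refine Finset.prod_le_prod (fun _ _ => by positivity) fun i _ => ?_
          have := card_div_le_card_of_mem_parts hP hPM (p (φ i)).2
          rw [Fintype.card_fin] at this
          rw [one_div_mul_eq_div]
          exact this
    · intro m hm
      simp only [Finset.mem_filter, Finset.mem_univ, true_and] at hm ⊢
      exact hm.2

theorem contains_Kparts_of_joined {V : Type*} (G : SimpleGraph V) {r p q : ℕ}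
    (x : Fin p → Fin r → V) (T : Finset V) (hq : q ≤ T.card)
    (hT : ∀ i, ∀ y ∈ T, ∀ a, G.Adj (x i a) y)
    (hinj : ∀ a, Function.Injective fun i => x i a)
    (hadj : ∀ a b, a ≠ b → ∀ i j, G.Adj (x i a) (x j b)) :
    Contains (Kparts r p q) G := by
  obtain ⟨e⟩ : Nonempty (Fin q ↪ T) := by
    apply Function.Embedding.nonempty_of_card_le
    simpa using hq
  let F : (i : Fin (r + 1)) → Fin (if (i : ℕ) < r then p else q) → V := fun i j =>
    if h : (i : ℕ) < r then x (Fin.cast (if_pos h) j) ⟨i, h⟩ else e (Fin.cast (if_neg h) j)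
  have hF₁ : ∀ (i : Fin (r + 1)) j (h : (i : ℕ) < r), F i j = x (Fin.cast (if_pos h) j) ⟨i, h⟩ :=
    fun i j h => dif_pos h
  have hF₂ : ∀ (i : Fin (r + 1)) j (h : ¬ (i : ℕ) < r), F i j = e (Fin.cast (if_neg h) j) :=
    fun i j h => dif_neg h
  have hF : ∀ i i' j j', i ≠ i' → G.Adj (F i j) (F i' j') := by
    intro i i' j j' hne
    by_cases h : (i : ℕ) < r <;> by_cases h' : (i' : ℕ) < r
    · rw [hF₁ i j h, hF₁ i' j' h']
      exact hadj _ _ (fun h0 => hne (Fin.ext (by simpa using h0))) _ _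
    · rw [hF₁ i j h, hF₂ i' j' h']
      exact hT _ _ (e _).2 _
    · rw [hF₂ i j h, hF₁ i' j' h']
      exact (hT _ _ (e _).2 _).symm
    · exact absurd (Fin.ext (by omega)) hne
  refine ⟨⟨fun z => F z.1 z.2, fun {z w} h => hF _ _ _ _ h⟩, ?_⟩
  rintro ⟨i, j⟩ ⟨i', j'⟩ h
  change F i j = F i' j' at h
  obtain rfl : i = i' := by
    by_contra hne
    exact (hF i i' j j' hne).ne h
  by_cases h0 : (i : ℕ) < r
  · rw [hF₁ i j h0, hF₁ i j' h0] at h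
    simpa using hinj _ h
  · rw [hF₂ i j h0, hF₂ i j' h0] at h
    simpa using e.injective (Subtype.ext h)

/-- A graph with a positive proportion of `(r + 1)`-cliques contains large complete
`(r + 1)`-partite graphs. -/
theorem exists_contains_Kparts_of_many_cliques (r : ℕ) {c : ℝ} (hc : 0 < c) :
    ∃ K : ℕ, 0 < K ∧ ∀ (n : ℕ) (G : SimpleGraph (Fin n)) [DecidableRel G.Adj],
      c * (n : ℝ) ^ (r + 1) ≤ ((Finset.univ.filter fun m : Fin (r + 1) → Fin n =>
          ∀ i j, i ≠ j → G.Adj (m i) (m j)).card : ℝ) →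
      ∀ p q : ℕ, 1 ≤ p → 1 ≤ q → K * q * 2 ^ (K * p) ≤ n → Contains (Kparts r p q) G := by
  obtain ⟨K, hK, h⟩ := exists_joined_cliques r hc
  refine ⟨K, hK, fun n G _ hM p q hp hq hn => ?_⟩
  obtain ⟨x, T, hT, hxM, hinj, hadj⟩ := h (Fin n) G _ (fun m hm => (Finset.mem_filter.1 hm).2)
    (by simpa using hM) p q hp hq (by simpa using hn)
  refine contains_Kparts_of_joined G x T hT (fun i y hy a => ?_) hinj hadj
  have := (Finset.mem_filter.1 (hxM i y hy)).2 a.castSucc (Fin.last r) (by simp)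
  simpa using this

theorem not_contains_Kparts_of_le_turanGraph {n r p q : ℕ} (hr : 0 < r) (hp : 1 ≤ p) (hq : 1 ≤ q)
    (G : SimpleGraph (Fin n)) (hG : G ≤ turanGraph n r) : ¬ Contains (Kparts r p q) G := by
  rintro ⟨f, -⟩
  have hpos : ∀ i : Fin (r + 1), 0 < if (i : ℕ) < r then p else q := by
    intro i
    split_ifs <;> omega
  let v : Fin (r + 1) → Fin n := fun i => f ⟨i, ⟨0, hpos i⟩⟩
  have hv : ∀ i j, i ≠ j → (v i : ℕ) % r ≠ v j % r := fun i j hij =>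
    hG (f.map_adj (show (Kparts r p q).Adj ⟨i, ⟨0, hpos i⟩⟩ ⟨j, ⟨0, hpos j⟩⟩ from hij))
  obtain ⟨i, j, hij, h⟩ := Fintype.exists_ne_map_eq_of_card_lt
    (fun i => (⟨v i % r, Nat.mod_lt _ hr⟩ : Fin r)) (by simp)
  exact hv i j hij (congrArg Fin.val h)

open Filter Topology in
theorem exists_forall_mul_mul_two_pow_le {K : ℕ} (hK : 0 < K) :
    ∃ δ : ℝ, 0 < δ ∧ ∃ N : ℕ, ∀ n ≥ N, 1 ≤ ⌊δ * Real.log n⌋₊ ∧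
      1 ≤ ⌈(n : ℝ) ^ (1 - Real.sqrt δ)⌉₊ ∧
      K * ⌈(n : ℝ) ^ (1 - Real.sqrt δ)⌉₊ * 2 ^ (K * ⌊δ * Real.log n⌋₊) ≤ n := by
  have hK0 : (0 : ℝ) < K := by exact_mod_cast hK
  have hK1 : (1 : ℝ) ≤ K := by exact_mod_cast hK
  have hδ : (0 : ℝ) < (1 / (2 * K)) ^ 2 := by positivity
  refine ⟨(1 / (2 * K)) ^ 2, hδ, ?_⟩
  rw [Real.sqrt_sq (by positivity)]
  have h1 : ∀ᶠ n : ℕ in atTop, 1 ≤ (1 / (2 * K : ℝ)) ^ 2 * Real.log n :=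
    ((Real.tendsto_log_atTop.comp tendsto_natCast_atTop_atTop).const_mul_atTop hδ).eventually_ge_atTop 1
  have h2 : ∀ᶠ n : ℕ in atTop, (2 * K : ℝ) ≤ (n : ℝ) ^ (1 / (4 * K : ℝ)) :=
    ((tendsto_rpow_atTop (show (0 : ℝ) < 1 / (4 * K) by positivity)).comp
      tendsto_natCast_atTop_atTop).eventually_ge_atTop _
  obtain ⟨N, hN⟩ := eventually_atTop.1 (h1.and (h2.and (eventually_ge_atTop 1)))
  refine ⟨N, fun n hn => ?_⟩
  obtain ⟨hlog, hpow, hn1⟩ := hN n hn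
  have hn0 : (0 : ℝ) < n := by exact_mod_cast hn1
  have hn1' : (1 : ℝ) ≤ n := by exact_mod_cast hn1
  refine ⟨(Nat.one_le_floor_iff _).2 hlog, Nat.one_le_ceil_iff.2 (by positivity), ?_⟩
  have hq : (⌈(n : ℝ) ^ (1 - 1 / (2 * K : ℝ))⌉₊ : ℝ) ≤ 2 * (n : ℝ) ^ (1 - 1 / (2 * K : ℝ)) := by
    have h3 := (Nat.ceil_lt_add_one (Real.rpow_nonneg hn0.le (1 - 1 / (2 * K : ℝ)))).le
    have h4 : 1 ≤ (n : ℝ) ^ (1 - 1 / (2 * K : ℝ)) := by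
      apply Real.one_le_rpow hn1'
      rw [sub_nonneg, div_le_one (by positivity)]
      linarith
    linarith
  have hp : (2 : ℝ) ^ (K * ⌊(1 / (2 * K : ℝ)) ^ 2 * Real.log n⌋₊) ≤ (n : ℝ) ^ (1 / (4 * K : ℝ)) := by
    rw [Real.rpow_def_of_pos hn0, ← Real.rpow_natCast, Real.rpow_def_of_pos two_pos]
    apply Real.exp_le_exp.2
    have h3 := Nat.floor_le (zero_le_one.trans hlog)
    push_cast
    have h4 : Real.log 2 ≤ 1 := Real.log_two_lt_d9.le.trans (by norm_num)
    have h5 : Real.log n * (1 / (4 * K)) = K * ((1 / (2 * K : ℝ)) ^ 2 * Real.log n) := by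
      field_simp
      norm_num
    rw [h5]
    calc Real.log 2 * (K * (⌊(1 / (2 * K : ℝ)) ^ 2 * Real.log n⌋₊ : ℝ))
        ≤ 1 * (K * (⌊(1 / (2 * K : ℝ)) ^ 2 * Real.log n⌋₊ : ℝ)) := by gcongr
      _ ≤ _ := by
        rw [one_mul]
        gcongr
  have hfin : (K * ⌈(n : ℝ) ^ (1 - 1 / (2 * K : ℝ))⌉₊ *
      2 ^ (K * ⌊(1 / (2 * K : ℝ)) ^ 2 * Real.log n⌋₊) : ℝ) ≤ n := by
    calc _ ≤ K * (2 * (n : ℝ) ^ (1 - 1 / (2 * K : ℝ))) * (n : ℝ) ^ (1 / (4 * K : ℝ)) := by gcongr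
      _ = (2 * K) * (n : ℝ) ^ (1 - 1 / (4 * K : ℝ)) := by
        rw [show (1 - 1 / (4 * K : ℝ)) = (1 - 1 / (2 * K : ℝ)) + 1 / (4 * K : ℝ) by
          field_simp; ring, Real.rpow_add hn0]
        ring
      _ ≤ (n : ℝ) ^ (1 / (4 * K : ℝ)) * (n : ℝ) ^ (1 - 1 / (4 * K : ℝ)) := by gcongr
      _ = n := by rw [← Real.rpow_add hn0]; simp
  exact_mod_cast hfin

set_option maxHeartbeats 1000000 in
/-- Let `P` be a class of graphs each lying, up to `η n ^ 2` edges, in a blow-up of a graph of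
bounded size containing no clique of size `r + 1`. If `η` is small then `P` is small. -/
theorem exists_logb_card_le (r : ℕ) (hr : 0 < r) {ε : ℝ} (hε : 0 < ε) :
    ∃ η : ℝ, 0 < η ∧ ∀ M : ℕ, 0 < M → ∃ N : ℕ, ∀ n ≥ N, ∀ P : SimpleGraph (Fin n) → Prop,
      0 < Nat.card {G : SimpleGraph (Fin n) // P G} →
      (∀ G, P G → ∃ (f : Fin n → Fin M) (R : SimpleGraph (Fin M)),
        (R.comap f).CliqueFree (r + 1) ∧
        ((G \ R.comap f).edgeSet.ncard : ℝ) ≤ η * (n : ℝ) ^ 2) →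
      Real.logb 2 (Nat.card {G : SimpleGraph (Fin n) // P G}) ≤
        (1 - 1 / (r : ℝ) + ε) * (n.choose 2 : ℝ) := by
  classical
  set x := min (ε / 8) 1 with hx
  have hx0 : 0 < x := by positivity
  have hx1 : x ≤ 1 := min_le_right _ _
  have hxε : x ≤ ε / 8 := min_le_left _ _
  set Λ := -Real.logb 2 x with hΛ
  have hΛ0 : 0 ≤ Λ := by
    rw [hΛ, neg_nonneg]
    exact Real.logb_nonpos one_lt_two hx0.le hx1
  refine ⟨ε / (16 * (Λ + 1)), by positivity, fun M hM => ?_⟩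
  set η := ε / (16 * (Λ + 1)) with hη
  have hη0 : 0 < η := by positivity
  have hηΛ : η * Λ ≤ ε / 16 := by
    rw [hη, div_mul_eq_mul_div, div_le_div_iff₀ (by positivity) (by positivity)]
    nlinarith
  set a := Real.logb 2 M
  set b := Real.logb 2 (Fintype.card (SimpleGraph (Fin M)))
  have hM1 : (1 : ℝ) ≤ M := by exact_mod_cast hM
  have hS1 : (1 : ℝ) ≤ Fintype.card (SimpleGraph (Fin M)) := by
    exact_mod_cast Fintype.card_pos
  have ha : 0 ≤ a := Real.logb_nonneg one_lt_two hM1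
  have hb : 0 ≤ b := Real.logb_nonneg one_lt_two hS1
  obtain ⟨N, hN⟩ := exists_nat_ge (8 * (a + b + 1) / ε)
  refine ⟨max N 2, fun n hn P hPpos hP => ?_⟩
  have hn2 : (2 : ℝ) ≤ n := by exact_mod_cast (le_max_right N 2).trans hn
  have hnN : 8 * (a + b + 1) ≤ n * ε := by
    rw [div_le_iff₀ hε] at hN
    have : (N : ℝ) ≤ n := by exact_mod_cast (le_max_left N 2).trans hn
    nlinarith
  have hr0 : (0 : ℝ) < r := by exact_mod_cast hr
  have hr1 : (0 : ℝ) ≤ 1 - 1 / r := by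
    rw [sub_nonneg, div_le_one hr0]
    exact_mod_cast hr
  have hr2 : 1 - 1 / (r : ℝ) ≤ 1 := by
    have : 0 ≤ 1 / (r : ℝ) := by positivity
    linarith
  have hcard := card_mul_pow_le_of_containers
    (fun i : (Fin n → Fin M) × SimpleGraph (Fin M) => i.2.comap i.1) P
    ⌊(1 - 1 / (r : ℝ)) * (n : ℝ) ^ 2 / 2⌋₊ ⌊η * (n : ℝ) ^ 2⌋₊ hx0.le hx1 (fun G hG => by
      obtain ⟨f, R, hfree, hle⟩ := hP G hG
      exact ⟨(f, R), Nat.le_floor (ncard_edgeSet_le_of_cliqueFree hr _ hfree), Nat.le_floor hle⟩)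
  have hPpos' : (0 : ℝ) < Nat.card {G : SimpleGraph (Fin n) // P G} := by exact_mod_cast hPpos
  have hlog := Real.logb_le_logb_of_le one_lt_two (by positivity) hcard
  rw [Fintype.card_prod, Fintype.card_fun, Fintype.card_fin, Fintype.card_fin] at hlog
  push_cast at hlog
  have hM0 : (M : ℝ) ≠ 0 := by positivity
  have hS0 : (Fintype.card (SimpleGraph (Fin M)) : ℝ) ≠ 0 := by positivity
  rw [Real.logb_mul (by positivity) (by positivity), Real.logb_mul (by positivity) (by positivity),
    Real.logb_mul (by positivity) (by positivity), Real.logb_mul (by positivity) (by positivity),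
    Real.logb_pow, Real.logb_pow, Real.logb_pow, Real.logb_pow,
    Real.logb_self_eq_one one_lt_two, mul_one] at hlog
  have he := Nat.floor_le (show 0 ≤ (1 - 1 / (r : ℝ)) * (n : ℝ) ^ 2 / 2 by positivity)
  have hm := Nat.floor_le (show 0 ≤ η * (n : ℝ) ^ 2 by positivity)
  have hx2 : Real.logb 2 (1 + x) ≤ ε / 4 := by
    rw [Real.logb, div_le_iff₀ (Real.log_pos one_lt_two)]
    have h1 := Real.log_le_sub_one_of_pos (show 0 < 1 + x by positivity)
    have h2 := Real.log_two_gt_d9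
    nlinarith
  have hmΛ := mul_le_mul_of_nonneg_right hm hΛ0
  have hch : (n.choose 2 : ℝ) = n * (n - 1) / 2 := Nat.cast_choose_two ℝ n
  have hch0 : (n : ℝ) ^ 2 / 4 ≤ n.choose 2 := by rw [hch]; nlinarith
  have hxc := mul_le_mul_of_nonneg_left hx2 (Nat.cast_nonneg (n.choose 2) : (0 : ℝ) ≤ _)
  have h1 : η * (n : ℝ) ^ 2 * Λ ≤ ε / 4 * n.choose 2 := by
    calc η * (n : ℝ) ^ 2 * Λ = η * Λ * (n : ℝ) ^ 2 := by ring
      _ ≤ ε / 16 * (n : ℝ) ^ 2 := by gcongr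
      _ = ε / 4 * ((n : ℝ) ^ 2 / 4) := by ring
      _ ≤ _ := by gcongr
  have h2 : (1 - 1 / (r : ℝ)) * (n : ℝ) ^ 2 / 2 ≤ (1 - 1 / (r : ℝ)) * n.choose 2 + n / 2 := by
    rw [hch]
    nlinarith
  have h3 : n * a + b + n / 2 ≤ ε / 2 * n.choose 2 := by
    calc n * a + b + n / 2 ≤ n * (a + b + 1) := by nlinarith
      _ ≤ n * (n * ε / 8) := by
        gcongr
        linarith
      _ = ε / 2 * ((n : ℝ) ^ 2 / 4) := by ring
      _ ≤ _ := by gcongr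
  have h4 : (⌊η * (n : ℝ) ^ 2⌋₊ : ℝ) * Real.logb 2 x = -(⌊η * (n : ℝ) ^ 2⌋₊ * Λ) := by
    rw [hΛ]
    ring
  rw [h4] at hlog
  linarith

theorem stmt3 (r : ℕ) (hr : 2 ≤ r) (ε : ℝ) (hε : 0 < ε) :
    ∃ δ : ℝ, 0 < δ ∧ ∃ N : ℕ, ∀ n ≥ N,
      (1 - 1/(r:ℝ)) * (n.choose 2 : ℝ) ≤
        Real.logb 2 (Nat.card {G : SimpleGraph (Fin n) //
          ¬ Contains (Kparts r ⌊δ * Real.log n⌋₊ ⌈(n:ℝ)^(1 - Real.sqrt δ)⌉₊) G}) ∧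
      Real.logb 2 (Nat.card {G : SimpleGraph (Fin n) //
          ¬ Contains (Kparts r ⌊δ * Real.log n⌋₊ ⌈(n:ℝ)^(1 - Real.sqrt δ)⌉₊) G}) ≤
        (1 - 1/(r:ℝ) + ε) * (n.choose 2 : ℝ) := by
  classical
  have hr0 : 0 < r := by omega
  obtain ⟨η, hη, hupper⟩ := exists_logb_card_le r hr0 hε
  obtain ⟨c, hc, M, N₁, hM, hcont⟩ := exists_many_cliques_or_container r hη
  obtain ⟨N₂, hupper⟩ := hupper M hM
  obtain ⟨K, hK, hblow⟩ := exists_contains_Kparts_of_many_cliques r hc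
  obtain ⟨δ, hδ, N₃, hsize⟩ := exists_forall_mul_mul_two_pow_le hK
  refine ⟨δ, hδ, max N₁ (max N₂ N₃), fun n hn => ?_⟩
  simp only [ge_iff_le, max_le_iff] at hn
  obtain ⟨hn₁, hn₂, hn₃⟩ := hn
  obtain ⟨hp, hq, hpq⟩ := hsize n hn₃
  have hlower := two_pow_card_edgeFinset_le_card_subgraphs (turanGraph n r)
    (fun G => ¬ Contains (Kparts r ⌊δ * Real.log n⌋₊ ⌈(n:ℝ)^(1 - Real.sqrt δ)⌉₊) G)
    (fun G hG => not_contains_Kparts_of_le_turanGraph hr0 hp hq G hG)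
  refine ⟨(le_card_edgeFinset_turanGraph hr0).trans ?_,
    hupper n hn₂ _ (lt_of_lt_of_le (by positivity) hlower) fun G hG => ?_⟩
  · have h1 := (Nat.cast_le (α := ℝ)).2 hlower
    push_cast at h1
    have h2 := Real.logb_le_logb_of_le one_lt_two (by positivity) h1
    rwa [Real.logb_pow, Real.logb_self_eq_one one_lt_two, mul_one] at h2
  · exact (hcont n hn₁ G).resolve_left fun h => hG (hblow n G h _ _ hp hq hpq)
end

section
/- Let r ≥ 3, let n be large, let (ln n)^{-1/r} ≤ c ≤ 1/2, and let G be a graph on n vertices containing more than c·n^r copies of K_r. Then G contains a copy of the complete r-partite graph K_r(s,...,s,t) with r-1 parts of size s = ⌊c^r ln n⌋ and one part of size t > n^{1 - c^{r-1}}. -/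
open SimpleGraph

/-- The complete r-partite graph with r-1 parts of size s and one part of size t. -/
def Krst (r s t : ℕ) : SimpleGraph (Σ i : Fin r, Fin (if (i:ℕ) < r - 1 then s else t)) :=
  SimpleGraph.completeMultipartiteGraph fun i : Fin r => Fin (if (i:ℕ) < r - 1 then s else t)

section Numerics

lemma mul_one_add_log_inv_le_half {c : ℝ} (hc0 : 0 < c) (hc6 : c ≤ 1 / 6) :
    c * (1 + Real.log c⁻¹) ≤ 1 / 2 := by
  have hlog6 : Real.log 6 ≤ 2 := by
    rw [Real.log_le_iff_le_exp (by norm_num)]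
    have h2 : Real.exp 2 = Real.exp 1 * Real.exp 1 := by rw [← Real.exp_add]; norm_num
    nlinarith [Real.exp_one_gt_d9]
  have h := Real.log_le_sub_one_of_pos (x := c⁻¹ / 6) (by positivity)
  rw [Real.log_div (by positivity) (by norm_num)] at h
  have hl : 1 + Real.log c⁻¹ ≤ c⁻¹ / 6 + 2 := by linarith
  calc c * (1 + Real.log c⁻¹) ≤ c * (c⁻¹ / 6 + 2) := by gcongr
    _ = 1 / 6 + 2 * c := by field_simp
    _ ≤ 1 / 2 := by linarith

lemma choose_floor_le_exp_half {c x : ℝ} (hc0 : 0 < c) (hc6 : c ≤ 1 / 6) (hx : 0 ≤ x) :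
    ((⌊x⌋₊.choose ⌊c * x⌋₊ : ℕ) : ℝ) ≤ Real.exp (x / 2) := by
  set s := ⌊c * x⌋₊
  have hs : (s : ℝ) ≤ c * x := Nat.floor_le (by positivity)
  have hlog : 0 ≤ Real.log c⁻¹ := Real.log_nonneg ((one_le_inv₀ hc0).2 (by linarith))
  calc ((⌊x⌋₊.choose s : ℕ) : ℝ) ≤ (⌊x⌋₊ : ℝ) ^ s / (s.factorial : ℝ) := Nat.choose_le_pow_div _ _
    _ ≤ x ^ s / (s.factorial : ℝ) := by
        gcongr
        exact Nat.floor_le hx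
    _ = c⁻¹ ^ s * ((c * x) ^ s / (s.factorial : ℝ)) := by
        rw [mul_pow, inv_pow]; field_simp
    _ ≤ c⁻¹ ^ s * Real.exp (c * x) := by
        gcongr
        exact Real.pow_div_factorial_le_exp _ (by positivity) _
    _ = Real.exp (s * Real.log c⁻¹ + c * x) := by
        rw [Real.exp_add, Real.exp_nat_mul, Real.exp_log (by positivity)]
    _ ≤ Real.exp (x / 2) := by
        rw [Real.exp_le_exp]
        have h1 : (s : ℝ) * Real.log c⁻¹ ≤ c * x * Real.log c⁻¹ := by gcongr
        have h2 := mul_le_mul_of_nonneg_right (mul_one_add_log_inv_le_half hc0 hc6) hx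
        nlinarith

lemma one_lt_mul_exp_half {c x : ℝ} (hc0 : 0 < c) (hc6 : c ≤ 1 / 6) (hx : 1 ≤ c * x) :
    1 < c * Real.exp (x / 2) := by
  have hx6 : 6 ≤ x := by
    by_contra! h
    nlinarith
  have h := Real.quadratic_le_exp_of_nonneg (x := x / 2) (by linarith)
  have h2 : x < Real.exp (x / 2) := by nlinarith
  nlinarith

lemma log_le_exp_half_log {n : ℝ} (hn : 1 ≤ n) :
    Real.log n ≤ Real.exp (Real.log n / 2) := by
  have h0 := Real.log_nonneg hn
  have h := Real.quadratic_le_exp_of_nonneg (x := Real.log n / 2) (by linarith)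
  nlinarith [sq_nonneg (Real.log n - 2)]

end Numerics

open Finset in
/-- A bipartite relation of density at least `2 * c` contains a complete bipartite piece with
`s` vertices on the left. -/
lemma exists_complete_bipartite {α β : Type*} [Fintype α] [Fintype β] [DecidableEq α]
    (R : α → β → Prop) [∀ a, DecidablePred (R a)] {c : ℝ} {s : ℕ} (hm : 0 < Fintype.card α)
    (hs : (s : ℝ) ≤ c * Fintype.card α + 1) (hsm : s ≤ Fintype.card α) (hc : 0 ≤ c)
    (hR : ∀ a, 2 * c * Fintype.card β ≤ (#{y | R a y} : ℝ)) :
    ∃ S : Finset α, #S = s ∧ ∃ Y : Finset β,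
      c * Fintype.card β ≤ #Y * ((Fintype.card α).choose s : ℝ) ∧ ∀ a ∈ S, ∀ y ∈ Y, R a y := by
  classical
  set m := Fintype.card α
  set n := Fintype.card β
  set Y₀ : Finset β := {y | s ≤ #{a | R a y}}
  have hm' : (0 : ℝ) < m := by exact_mod_cast hm
  have hY₀ : c * n ≤ #Y₀ := by
    have hcount : ∑ a : α, (#{y | R a y} : ℝ) = ∑ y : β, (#{a | R a y} : ℝ) := by
      exact_mod_cast sum_card_bipartiteAbove_eq_sum_card_bipartiteBelow (s := univ) (t := univ) R
    have hlow : (m : ℝ) * (2 * c * n) ≤ ∑ a : α, (#{y | R a y} : ℝ) := by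
      have := Finset.card_nsmul_le_sum univ (fun a : α => (#{y | R a y} : ℝ)) _ fun a _ => hR a
      simpa [m] using this
    have hup : ∑ y : β, (#{a | R a y} : ℝ) ≤ ∑ y : β, ((if y ∈ Y₀ then (m : ℝ) else 0) + c * m) := by
      refine sum_le_sum fun y _ => ?_
      split_ifs with hy
      · have : (#{a | R a y} : ℝ) ≤ m := by exact_mod_cast card_le_univ _
        have : 0 ≤ c * m := by positivity
        linarith
      · have h : #{a | R a y} + 1 ≤ s := by
          simp only [Y₀, mem_filter, mem_univ, true_and] at hy
          omega
        have h' : (#{a | R a y} : ℝ) + 1 ≤ s := by exact_mod_cast h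
        linarith
    have hsum : ∑ y : β, ((if y ∈ Y₀ then (m : ℝ) else 0) + c * m) = #Y₀ * m + n * (c * m) := by
      rw [sum_add_distrib, sum_ite_mem]
      simp [n]
    have : m * (c * n) ≤ m * (#Y₀ : ℝ) := by nlinarith
    exact le_of_mul_le_mul_left this hm'
  have hsub : ∀ y : β, ∃ S : Finset α, y ∈ Y₀ → #S = s ∧ ∀ a ∈ S, R a y := by
    intro y
    by_cases hy : y ∈ Y₀
    · obtain ⟨S, hS, hcard⟩ := exists_subset_card_eq (mem_filter.1 hy).2
      exact ⟨S, fun _ => ⟨hcard, fun a ha => (mem_filter.1 (hS ha)).2⟩⟩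
    · exact ⟨∅, fun h => absurd h hy⟩
  choose F hF using hsub
  have hmaps : ∀ y ∈ Y₀, F y ∈ powersetCard s (univ : Finset α) := fun y hy =>
    mem_powersetCard.2 ⟨subset_univ _, (hF y hy).1⟩
  have hne : (powersetCard s (univ : Finset α)).Nonempty := by
    rw [powersetCard_nonempty]; exact hsm
  have hpos : (0 : ℝ) < (m.choose s : ℝ) := by exact_mod_cast Nat.choose_pos hsm
  obtain ⟨S, hS, hcard⟩ := exists_le_card_fiber_of_nsmul_le_card_of_maps_to hmaps hne
    (b := (#Y₀ : ℝ) / (m.choose s : ℝ)) (by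
      rw [card_powersetCard, card_univ, nsmul_eq_mul]
      exact (mul_div_cancel₀ _ hpos.ne').le)
  refine ⟨S, (mem_powersetCard.1 hS).2, _, hY₀.trans ((div_le_iff₀ hpos).1 hcard), ?_⟩
  intro a ha y hy
  obtain ⟨hyY, rfl⟩ := mem_filter.1 hy
  exact (hF y hyY).2 a ha

open Finset in
lemma card_dense_prefixes {V : Type*} [Fintype V] [DecidableEq V] [Nonempty V] {c : ℝ}
    (hc : 0 ≤ c) (j : ℕ) (T : Finset (Fin (j + 1) → V))
    (hT : 2 * c * ((j + 1 : ℕ) : ℝ) * (Fintype.card V : ℝ) ^ (j + 1) < #T) :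
    2 * c * (j : ℝ) * (Fintype.card V : ℝ) ^ j <
      #{x : Fin j → V | 2 * c * Fintype.card V ≤ #{y | (Fin.snoc x y : Fin (j + 1) → V) ∈ T}} := by
  classical
  set n := Fintype.card V
  have hn : (0 : ℝ) < n := by exact_mod_cast Fintype.card_pos
  set D : (Fin j → V) → ℕ := fun x => #{y | (Fin.snoc x y : Fin (j + 1) → V) ∈ T}
  have hsum : #T = ∑ x : Fin j → V, D x := by
    rw [card_eq_sum_card_fiberwise (f := Fin.init) (t := univ) (by simp)]
    refine sum_congr rfl fun x _ => ?_
    refine card_nbij' (fun z => z (Fin.last j)) (fun y => Fin.snoc x y) ?_ ?_ ?_ ?_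
    · intro z hz
      simp only [coe_filter, Set.mem_ofPred_eq] at hz
      obtain ⟨hz, rfl⟩ := hz
      simpa using hz
    · intro y hy
      simpa using hy
    · intro z hz
      simp only [coe_filter, Set.mem_ofPred_eq] at hz
      obtain ⟨hz, rfl⟩ := hz
      simp
    · intro y _
      simp
  set P : Finset (Fin j → V) := {x | 2 * c * n ≤ D x}
  have hup : (#T : ℝ) ≤ #P * n + (n : ℝ) ^ j * (2 * c * n) := by
    calc (#T : ℝ) = ∑ x : Fin j → V, (D x : ℝ) := by rw [hsum]; push_cast; rfl
      _ ≤ ∑ x : Fin j → V, ((if x ∈ P then (n : ℝ) else 0) + 2 * c * n) := by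
        refine sum_le_sum fun x _ => ?_
        split_ifs with hx
        · have : (D x : ℝ) ≤ n := by exact_mod_cast card_le_univ _
          have : 0 ≤ 2 * c * n := by positivity
          linarith
        · simp only [P, mem_filter, mem_univ, true_and, not_le] at hx
          linarith
      _ = #P * n + (n : ℝ) ^ j * (2 * c * n) := by
        rw [sum_add_distrib, sum_ite_mem]
        simp [n]
  have h : 2 * c * (j : ℝ) * (n : ℝ) ^ j * n < #P * n := by
    push_cast at hT
    have : 2 * c * ((j : ℝ) + 1) * (n : ℝ) ^ (j + 1) =
      2 * c * (j : ℝ) * (n : ℝ) ^ j * n + (n : ℝ) ^ j * (2 * c * n) := by ring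
    linarith
  exact lt_of_mul_lt_mul_right h hn.le

section Families

variable {V : Type*} (G : SimpleGraph V)

/-- A tuple of pairwise adjacent vertices. -/
def IsCliqueTuple {j : ℕ} (x : Fin j → V) : Prop := ∀ i k, i ≠ k → G.Adj (x i) (x k)

/-- A family of `m` tuples whose `i`-th coordinates form the `i`-th part of a complete
`j`-partite subgraph with parts of size `m`. -/
structure IsMultipartiteFamily {m j : ℕ} (f : Fin m → Fin j → V) : Prop where
  inj : ∀ i, Function.Injective fun a => f a i
  adj : ∀ a b i k, i ≠ k → G.Adj (f a i) (f b k)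

variable {G}

open Finset in
/-- A dense set of tuples of length `j + 1` contains all one-vertex extensions by a large set `Y`
of some members `S` of a multipartite family, provided dense sets of tuples of length `j` contain
large multipartite families. -/
lemma exists_common_extensions [Fintype V] [DecidableEq V] [Nonempty V] {c : ℝ} (hc0 : 0 < c) (hc6 : c ≤ 1 / 6) {j : ℕ}
    (hj : 1 ≤ c ^ j * Real.log (Fintype.card V))
    (ih : ∀ T : Finset (Fin j → V), 2 * c * (j : ℝ) * (Fintype.card V : ℝ) ^ j < #T →
      (∀ x ∈ T, IsCliqueTuple G x) → ∃ f : Fin ⌊c ^ j * Real.log (Fintype.card V)⌋₊ → Fin j → V,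
        (∀ a, f a ∈ T) ∧ IsMultipartiteFamily G f)
    (T : Finset (Fin (j + 1) → V))
    (hT : 2 * c * ((j + 1 : ℕ) : ℝ) * (Fintype.card V : ℝ) ^ (j + 1) < #T)
    (hG : ∀ x ∈ T, IsCliqueTuple G x) :
    ∃ f : Fin ⌊c ^ j * Real.log (Fintype.card V)⌋₊ → Fin j → V, IsMultipartiteFamily G f ∧
      ∃ S, #S = ⌊c ^ (j + 1) * Real.log (Fintype.card V)⌋₊ ∧ ∃ Y : Finset V,
        c * Fintype.card V ≤ #Y * Real.exp (c ^ j * Real.log (Fintype.card V) / 2) ∧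
        ∀ a ∈ S, ∀ y ∈ Y, (Fin.snoc (f a) y : Fin (j + 1) → V) ∈ T := by
  classical
  have hx : c ^ (j + 1) * Real.log (Fintype.card V) = c * (c ^ j * Real.log (Fintype.card V)) := by
    ring
  rw [hx]
  set x := c ^ j * Real.log (Fintype.card V)
  obtain ⟨f, hfT, hf⟩ := ih _ (card_dense_prefixes hc0.le j T hT) (by
    intro z hz i k hik
    have hn : (0 : ℝ) < Fintype.card V := by exact_mod_cast Fintype.card_pos
    have hpos : (0 : ℝ) < #{y | (Fin.snoc z y : Fin (j + 1) → V) ∈ T} :=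
      lt_of_lt_of_le (by positivity) (mem_filter.1 hz).2
    obtain ⟨y, hy⟩ := card_pos.1 (Nat.cast_pos.1 hpos)
    simpa using hG _ (mem_filter.1 hy).2 i.castSucc k.castSucc (by simpa using hik))
  have hx0 : 0 ≤ x := by linarith
  have hfl := Nat.lt_floor_add_one x
  have hcx : (⌊c * x⌋₊ : ℝ) ≤ c * x := Nat.floor_le (by positivity)
  obtain ⟨S, hS, Y, hY, hSY⟩ := exists_complete_bipartite
    (fun (a : Fin ⌊x⌋₊) y => (Fin.snoc (f a) y : Fin (j + 1) → V) ∈ T) (c := c) (s := ⌊c * x⌋₊)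
    (by rw [Fintype.card_fin]; exact Nat.floor_pos.2 hj) (by simp only [Fintype.card_fin]; nlinarith)
    (by
      simp only [Fintype.card_fin]
      exact Nat.floor_mono (by nlinarith)) hc0.le (fun a => (mem_filter.1 (hfT a)).2)
  refine ⟨f, hf, S, hS, Y, hY.trans ?_, hSY⟩
  rw [Fintype.card_fin]
  gcongr
  exact choose_floor_le_exp_half hc0 hc6 hx0

open Finset in
lemma exists_multipartiteFamily [Fintype V] [DecidableEq V] [Nonempty V] {c : ℝ} (hc0 : 0 < c)
    (hc6 : c ≤ 1 / 6) (j : ℕ)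
    (hj : 1 ≤ c ^ j * Real.log (Fintype.card V)) (T : Finset (Fin j → V))
    (hT : 2 * c * (j : ℝ) * (Fintype.card V : ℝ) ^ j < #T) (hG : ∀ x ∈ T, IsCliqueTuple G x) :
    ∃ f : Fin ⌊c ^ j * Real.log (Fintype.card V)⌋₊ → Fin j → V,
      (∀ a, f a ∈ T) ∧ IsMultipartiteFamily G f := by
  induction j with
  | zero =>
    obtain ⟨x, hx⟩ : T.Nonempty := by
      rw [← card_pos]
      simpa using hT
    exact ⟨fun _ => x, fun _ => hx, ⟨fun i => i.elim0, fun _ _ i => i.elim0⟩⟩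
  | succ j ih =>
    have hn1 : (1 : ℝ) ≤ Fintype.card V := by exact_mod_cast Fintype.card_pos
    have hlog : 0 ≤ Real.log (Fintype.card V) := Real.log_nonneg hn1
    have hx0 : 0 ≤ c ^ j * Real.log (Fintype.card V) := by positivity
    have hj' : 1 ≤ c ^ j * Real.log (Fintype.card V) := by
      rw [pow_succ] at hj
      nlinarith
    set L := Real.log (Fintype.card V)
    set s := ⌊c ^ (j + 1) * L⌋₊
    obtain ⟨f, hf, S, hS, Y, hY, hSY⟩ := exists_common_extensions hc0 hc6 hj' (ih hj') T hT hG
    have hsY : s ≤ #Y := by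
      have h1 : (s : ℝ) ≤ c ^ (j + 1) * L := Nat.floor_le (by positivity)
      have h2 : c ^ (j + 1) * L ≤ c * L := by
        have : c ^ (j + 1) ≤ c := pow_le_of_le_one hc0.le (by linarith) (by simp)
        gcongr
      have h3 : c ^ j * L / 2 ≤ L / 2 := by
        have : c ^ j ≤ 1 := pow_le_one₀ hc0.le (by linarith)
        nlinarith
      have h4 : c * Real.exp (L / 2) * Real.exp (L / 2) ≤ #Y * Real.exp (L / 2) := by
        calc c * Real.exp (L / 2) * Real.exp (L / 2) = c * Fintype.card V := by
              rw [mul_assoc, ← Real.exp_add, add_halves, Real.exp_log (by linarith)]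
          _ ≤ _ := hY
          _ ≤ _ := by gcongr
      have h5 := le_of_mul_le_mul_right h4 (Real.exp_pos _)
      have h6 : c * L ≤ c * Real.exp (L / 2) := by
        gcongr
        exact log_le_exp_half_log hn1
      have : (s : ℝ) ≤ #Y := by linarith
      exact_mod_cast this
    obtain ⟨Y', hY', hY's⟩ := exists_subset_card_eq hsY
    let e := S.orderEmbOfFin hS
    let e' : Fin s → V := fun a => (Y'.equivFinOfCardEq hY's).symm a
    have he : ∀ a, e a ∈ S := fun a => S.orderEmbOfFin_mem hS a
    have he' : ∀ a, e' a ∈ Y := fun a => hY' (Subtype.coe_prop _)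
    refine ⟨fun a => Fin.snoc (f (e a)) (e' a), fun a => hSY _ (he a) _ (he' a), ⟨?_, ?_⟩⟩
    · intro i
      refine Fin.lastCases ?_ (fun i => ?_) i
      · simp only [Fin.snoc_last]
        exact Subtype.val_injective.comp (Equiv.injective _)
      · simp only [Fin.snoc_castSucc]
        exact (hf.inj i).comp e.injective
    · intro a b i k
      refine Fin.lastCases ?_ (fun i => ?_) i <;> refine Fin.lastCases ?_ (fun k => ?_) k
      · simp
      · intro _
        simpa using hG _ (hSY _ (he b) _ (he' a)) (Fin.last j) k.castSucc
          (Fin.castSucc_lt_last k).ne'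
      · intro _
        simpa using hG _ (hSY _ (he a) _ (he' b)) i.castSucc (Fin.last j)
          (Fin.castSucc_lt_last i).ne
      · intro hik
        simpa using hf.adj (e a) (e b) i k (by simpa using hik)

lemma contains_completeMultipartiteGraph {ι : Type*} (k : ι → ℕ) (P : ι → Finset V)
    (hP : ∀ i, k i ≤ (P i).card) (hadj : ∀ i i', i ≠ i' → ∀ a ∈ P i, ∀ b ∈ P i', G.Adj a b) :
    Contains (completeMultipartiteGraph fun i => Fin (k i)) G := by
  have hp : ∀ i, ∃ p : Fin (k i) → V, Function.Injective p ∧ ∀ a, p a ∈ P i := fun i =>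
    ⟨fun a => (P i).equivFin.symm (Fin.castLE (hP i) a),
      Subtype.val_injective.comp ((Equiv.injective _).comp (Fin.castLE_injective _)),
      fun a => Subtype.coe_prop _⟩
  choose p hinj hmem using hp
  refine ⟨⟨fun z => p z.1 z.2, fun {z w} h => hadj _ _ h _ (hmem _ _) _ (hmem _ _)⟩, ?_⟩
  rintro ⟨i, a⟩ ⟨i', b⟩ h
  by_cases hi : i = i'
  · subst hi
    exact congrArg _ (hinj i h)
  · exact absurd h (hadj _ _ hi _ (hmem i a) _ (hmem i' b)).ne

open Classical in
lemma factorial_mul_card_isNClique_le [Fintype V] (r : ℕ) :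
    r.factorial * Nat.card {S : Finset V // G.IsNClique r S} ≤
      (Finset.univ.filter fun x : Fin r → V => IsCliqueTuple G x).card := by
  let e : ∀ S : {S : Finset V // G.IsNClique r S}, Fin r ≃ S.1 := fun S =>
    (S.1.equivFinOfCardEq S.2.card_eq).symm
  let F : Equiv.Perm (Fin r) × {S : Finset V // G.IsNClique r S} →
      {x : Fin r → V // IsCliqueTuple G x} := fun q =>
    ⟨fun i => e q.2 (q.1 i), fun i k hik =>
      q.2.2.isClique (Subtype.coe_prop _) (Subtype.coe_prop _) fun h =>
        hik (q.1.injective ((e q.2).injective (Subtype.ext h)))⟩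
  have hF : Function.Injective F := by
    rintro ⟨σ, S⟩ ⟨τ, S'⟩ h
    have h' : ∀ i, (e S (σ i) : V) = e S' (τ i) := fun i => congrFun (congrArg Subtype.val h) i
    have hS : S = S' := by
      refine Subtype.ext (Finset.eq_of_subset_of_card_le (fun v hv => ?_) ?_)
      · obtain ⟨i, hi⟩ := (σ.trans (e S)).surjective ⟨v, hv⟩
        have hi' : (e S (σ i) : V) = v := congrArg Subtype.val hi
        rw [← hi', h' i]
        exact Subtype.coe_prop _
      · rw [S.2.card_eq, S'.2.card_eq]
    subst hS
    have : σ = τ := Equiv.ext fun i => (e S).injective (Subtype.ext (h' i))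
    rw [this]
  have h := Nat.card_le_card_of_injective F hF
  rw [Nat.card_prod, Nat.card_eq_fintype_card, Fintype.card_perm, Fintype.card_fin] at h
  refine h.trans_eq ?_
  rw [Nat.card_eq_fintype_card, Fintype.card_subtype]

end Families

lemma two_mul_le_factorial {r : ℕ} (hr : 3 ≤ r) : 2 * r ≤ r.factorial := by
  obtain ⟨k, rfl⟩ : ∃ k, r = k + 1 := ⟨r - 1, by omega⟩
  rw [Nat.factorial_succ, mul_comm]
  gcongr
  exact le_trans (by omega) (Nat.self_le_factorial k)

theorem stmt8 (r : ℕ) (hr : 3 ≤ r) :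
    ∃ N : ℕ, ∀ n ≥ N, ∀ c : ℝ,
      (Real.log n) ^ (-(1/(r:ℝ))) ≤ c → c ≤ 1/2 →
      ∀ G : SimpleGraph (Fin n),
        (c * (n:ℝ)^r < (Nat.card {S : Finset (Fin n) // G.IsNClique r S} : ℝ)) →
        ∃ t : ℕ, (n:ℝ)^(1 - c^(r-1)) < (t:ℝ) ∧
          Contains (Krst r ⌊c^r * Real.log n⌋₊ t) G := by
  classical
  refine ⟨2, fun n hn c hc _ G hG => ?_⟩
  have hn1 : (1 : ℝ) < n := by exact_mod_cast hn
  have hL : 0 < Real.log n := Real.log_pos hn1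
  have hc0 : 0 < c := (Real.rpow_pos_of_pos hL _).trans_le hc
  have hcL : 1 ≤ c ^ r * Real.log n := by
    have h := pow_le_pow_left₀ (Real.rpow_nonneg hL.le _) hc r
    rw [← Real.rpow_natCast, ← Real.rpow_mul hL.le,
      show -(1 / (r : ℝ)) * (r : ℝ) = -1 by field_simp, Real.rpow_neg_one] at h
    calc 1 = (Real.log n)⁻¹ * Real.log n := (inv_mul_cancel₀ hL.ne').symm
      _ ≤ _ := by gcongr
  set T : Finset (Fin r → Fin n) := Finset.univ.filter fun x => IsCliqueTuple G x
  have hT' : (r.factorial : ℝ) * (c * (n : ℝ) ^ r) < T.card := by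
    refine lt_of_lt_of_le (mul_lt_mul_of_pos_left hG (by positivity)) ?_
    exact_mod_cast factorial_mul_card_isNClique_le (G := G) r
  have hc6 : c ≤ 1 / 6 := by
    have h1 : (T.card : ℝ) ≤ (n : ℝ) ^ r := by
      have := Finset.card_le_univ T
      rw [Fintype.card_fun, Fintype.card_fin, Fintype.card_fin] at this
      exact_mod_cast this
    have h2 : (6 : ℝ) ≤ r.factorial := by exact_mod_cast Nat.factorial_le hr
    have h3 : (0 : ℝ) < (n : ℝ) ^ r := by positivity
    have h4 : 6 * (c * (n : ℝ) ^ r) ≤ r.factorial * (c * (n : ℝ) ^ r) := by gcongr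
    by_contra! h
    nlinarith
  obtain ⟨j, rfl⟩ : ∃ j, r = j + 1 := ⟨r - 1, by omega⟩
  have hT : 2 * c * ((j + 1 : ℕ) : ℝ) * (n : ℝ) ^ (j + 1) < T.card := by
    refine lt_of_le_of_lt ?_ hT'
    have h2 : (2 * ((j + 1 : ℕ) : ℝ)) ≤ (j + 1).factorial := by exact_mod_cast two_mul_le_factorial hr
    calc _ = 2 * ((j + 1 : ℕ) : ℝ) * (c * (n : ℝ) ^ (j + 1)) := by ring
      _ ≤ _ := by gcongr
  have hTG : ∀ x ∈ T, IsCliqueTuple G x := fun x hx => (Finset.mem_filter.1 hx).2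
  have hcx : 1 ≤ c * (c ^ j * Real.log n) := by rw [← mul_assoc, ← pow_succ']; exact hcL
  have hx1 : 1 ≤ c ^ j * Real.log n := by
    have : 0 < c ^ j * Real.log n := by positivity
    nlinarith
  have : Nonempty (Fin n) := ⟨⟨0, by omega⟩⟩
  have key := exists_common_extensions (G := G) hc0 hc6 (j := j) (by simpa using hx1)
    (exists_multipartiteFamily hc0 hc6 j (by simpa using hx1)) T (by simpa using hT) hTG
  simp only [Fintype.card_fin] at key
  obtain ⟨f, hf, S, hS, Y, hY, hSY⟩ := key
  refine ⟨Y.card, ?_, ?_⟩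
  · set x := c ^ j * Real.log n
    have hexp := one_lt_mul_exp_half hc0 hc6 hcx
    have hn_pow : (n : ℝ) ^ (1 - c ^ (j + 1 - 1)) * Real.exp x = n := by
      rw [Real.rpow_def_of_pos (by linarith), ← Real.exp_add]
      simp only [Nat.add_sub_cancel, x]
      rw [show Real.log n * (1 - c ^ j) + c ^ j * Real.log n = Real.log n by ring,
        Real.exp_log (by linarith)]
    refine lt_of_mul_lt_mul_right (a := Real.exp x) ?_ (Real.exp_pos _).le
    rw [hn_pow]
    calc (n : ℝ) < n * (c * Real.exp (x / 2)) := lt_mul_of_one_lt_right (by linarith) hexp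
      _ = c * n * Real.exp (x / 2) := by ring
      _ ≤ Y.card * Real.exp (x / 2) * Real.exp (x / 2) := by gcongr
      _ = Y.card * Real.exp x := by rw [mul_assoc, ← Real.exp_add, add_halves]
  · refine contains_completeMultipartiteGraph _
      (fun i : Fin (j + 1) => Fin.lastCases (motive := fun _ => Finset (Fin n)) Y
        (fun k => S.image fun a => f a k) i) ?_ ?_
    · intro i
      refine Fin.lastCases ?_ (fun k => ?_) i
      · simp
      · simp [Finset.card_image_of_injective S (hf.inj k), hS]
    · intro i i'
      refine Fin.lastCases ?_ (fun k => ?_) i <;> refine Fin.lastCases ?_ (fun k' => ?_) i'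
      · simp
      · intro _ y hy b hb
        simp only [Fin.lastCases_last, Fin.lastCases_castSucc, Finset.mem_image] at hy hb
        obtain ⟨a, ha, rfl⟩ := hb
        simpa using hTG _ (hSY a ha y hy) (Fin.last j) k'.castSucc (Fin.castSucc_lt_last k').ne'
      · intro _ b hb y hy
        simp only [Fin.lastCases_last, Fin.lastCases_castSucc, Finset.mem_image] at hy hb
        obtain ⟨a, ha, rfl⟩ := hb
        simpa using hTG _ (hSY a ha y hy) k.castSucc (Fin.last j) (Fin.castSucc_lt_last k).ne
      · intro hkk b hb b' hb'
        simp only [Fin.lastCases_castSucc, Finset.mem_image] at hb hb'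
        obtain ⟨a, _, rfl⟩ := hb
        obtain ⟨a', _, rfl⟩ := hb'
        exact hf.adj a a' k k' (by simpa using hkk)
end

section
/- Let H be a fixed graph on h vertices, let 2 ≤ h ≤ n, (ln n)^{-1/h²} ≤ c ≤ 1/4, and let G be a graph on n vertices containing more than c·n^h induced copies of H. Then G contains an induced subgraph of type H(s,...,s,t) with s = ⌊c^{h²} ln n⌋ and t > n^{1 - c^{h-1}}. -/
open SimpleGraph

/-- `F` is a blowup of type `H(p 0, ..., p (h-1))`: between distinct parts `u ≠ v`, `F` is
complete bipartite if `uv ∈ E(H)` and empty if `uv ∉ E(H)`; within parts `F` is arbitrary. -/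
def IsBlowupOfType {h : ℕ} (H : SimpleGraph (Fin h)) (p : Fin h → ℕ)
    (F : SimpleGraph (Σ u : Fin h, Fin (p u))) : Prop :=
  ∀ (u v : Fin h) (a : Fin (p u)) (b : Fin (p v)), u ≠ v →
    (F.Adj ⟨u, a⟩ ⟨v, b⟩ ↔ H.Adj u v)

/-- `G` contains an induced subgraph of type `H(p 0, ..., p (h-1))`. -/
def ContainsInducedType {h : ℕ} {β : Type*} (H : SimpleGraph (Fin h)) (p : Fin h → ℕ)
    (G : SimpleGraph β) : Prop :=
  ∃ F : SimpleGraph (Σ u : Fin h, Fin (p u)), IsBlowupOfType H p F ∧ Nonempty (F ↪g G)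

open Finset in
/-- If every row of a relation between `Fin m` and `V` has density at least `δ`, then some `s` rows
have many common neighbours. -/
theorem exists_rows_with_many_common_neighbours {V : Type*} [Fintype V] [Nonempty V] {m s : ℕ}
    (E : Fin m → V → Prop) {δ : ℝ} (hδ : 0 < δ) (hm : 0 < m)
    (hE : ∀ i, δ * Fintype.card V ≤ (Nat.card {v // E i v} : ℝ)) (hs : (s : ℝ) ≤ δ * m / 2) :
    ∃ (f : Fin s ↪ Fin m) (T : Finset V), (∀ i, ∀ v ∈ T, E (f i) v) ∧
      δ / 2 * Fintype.card V ≤ 2 ^ m * (#T : ℝ) := by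
  classical
  have hn : (0 : ℝ) < Fintype.card V := by exact_mod_cast Fintype.card_pos
  have hm' : (0 : ℝ) < m := by exact_mod_cast hm
  let nbr : V → Finset (Fin m) := fun v => {i | E i v}
  let W : Finset V := {v | δ * m / 2 ≤ (#(nbr v) : ℝ)}
  have hsum : ∑ v, (#(nbr v) : ℝ) = ∑ i, (Nat.card {v // E i v} : ℝ) := by
    have := Finset.sum_card_bipartiteAbove_eq_sum_card_bipartiteBelow (s := univ) (t := univ) E
    simp only [Nat.card_eq_fintype_card, Fintype.card_subtype]
    exact_mod_cast this.symm
  have hlower : δ * Fintype.card V * m ≤ ∑ v, (#(nbr v) : ℝ) := by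
    rw [hsum]
    calc δ * Fintype.card V * m = ∑ _i : Fin m, δ * Fintype.card V := by simp [mul_comm]
      _ ≤ _ := Finset.sum_le_sum fun i _ => hE i
  have hupper : ∑ v, (#(nbr v) : ℝ) ≤ #W * m + Fintype.card V * (δ * m / 2) := by
    calc ∑ v, (#(nbr v) : ℝ) ≤ ∑ v, ((if v ∈ W then (m : ℝ) else 0) + δ * m / 2) := by
          refine Finset.sum_le_sum fun v _ => ?_
          have h1 : (#(nbr v) : ℝ) ≤ m := by
            have := Finset.card_le_univ (nbr v)
            rw [Fintype.card_fin] at this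
            exact_mod_cast this
          split_ifs with hv
          · have : 0 < δ * m / 2 := by positivity
            linarith
          · simp only [W, mem_filter, mem_univ, true_and, not_le] at hv
            linarith
      _ = _ := by simp [Finset.sum_add_distrib]
  have hW : δ / 2 * Fintype.card V ≤ #W := by
    refine le_of_mul_le_mul_right ?_ hm'
    nlinarith
  obtain ⟨A, -, hA⟩ := Finset.exists_le_card_fiber_of_nsmul_le_card_of_maps_to
    (s := W) (t := univ) (f := nbr) (b := (#W : ℝ) / 2 ^ m) (fun _ _ => mem_univ _)
    univ_nonempty (by simp; field_simp; rfl)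
  have hWpos : (0 : ℝ) < #W := lt_of_lt_of_le (by positivity) hW
  obtain ⟨v, hv⟩ : ({v ∈ W | nbr v = A} : Finset V).Nonempty := by
    rw [← Finset.card_pos]
    have : (0 : ℝ) < #{v ∈ W | nbr v = A} := lt_of_lt_of_le (by positivity) hA
    exact_mod_cast this
  have hsA : s ≤ #A := by
    simp only [W, mem_filter, mem_univ, true_and] at hv
    have := hs.trans hv.1
    rw [hv.2] at this
    exact_mod_cast this
  obtain ⟨g⟩ : Nonempty (Fin s ↪ A) :=
    Function.Embedding.nonempty_of_card_le (by simpa using hsA)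
  refine ⟨g.trans (Function.Embedding.subtype _), {v ∈ W | nbr v = A}, fun i v hv => ?_, ?_⟩
  · have h1 : (g i : Fin m) ∈ nbr v := by rw [(mem_filter.1 hv).2]; exact (g i).2
    simpa [nbr] using h1
  · rw [div_le_iff₀ (by positivity)] at hA
    linarith

/-- The rows of `x` are tuples with distinct entries in each coordinate, and entries in different
coordinates, possibly of different rows, are related by `R`. -/
def CrossRelated {V : Type*} {k s : ℕ} (R : Fin k → Fin k → V → V → Prop)
    (x : Fin s → Fin k → V) : Prop :=
  (∀ j, Function.Injective fun i => x i j) ∧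
    ∀ i i' j j', j ≠ j' → R j j' (x i j) (x i' j')

open Finset in
/-- Among the `k`-prefixes of a dense set of `(k + 1)`-tuples, those with many extensions are
dense. -/
theorem card_prefixes_with_many_extensions {V : Type*} [Fintype V] [Nonempty V] {k : ℕ} {δ : ℝ}
    (hδ : 0 ≤ δ) (M : Finset (Fin (k + 1) → V)) (M' : Finset (Fin k → V))
    (hM' : ∀ x, x ∈ M' ↔
      δ * Fintype.card V ≤ (Nat.card {v // (Fin.snoc x v : Fin (k + 1) → V) ∈ M} : ℝ))
    (hM : ((k + 1 : ℕ) : ℝ) * δ * Fintype.card V ^ (k + 1) < #M) :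
    (k : ℝ) * δ * Fintype.card V ^ k < #M' := by
  classical
  have hn : (0 : ℝ) < Fintype.card V := by exact_mod_cast Fintype.card_pos
  have hcount : (#M : ℝ) =
      ∑ x : Fin k → V, (Nat.card {v // (Fin.snoc x v : Fin (k + 1) → V) ∈ M} : ℝ) := by
    have h1 : #M = ∑ x : Fin k → V, #{y ∈ M | Fin.init y = x} :=
      Finset.card_eq_sum_card_fiberwise (f := fun y : Fin (k + 1) → V => (Fin.init y : Fin k → V))
        (fun _ _ => by simp)
    rw [h1]
    push_cast
    refine Finset.sum_congr rfl fun x _ => ?_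
    rw [Nat.card_eq_fintype_card, Fintype.card_subtype]
    congr 1
    refine Finset.card_bij' (fun y _ => y (Fin.last k)) (fun v _ => Fin.snoc x v) ?_ ?_ ?_ ?_
    · rintro y hy
      simp only [mem_filter, mem_univ, true_and] at hy ⊢
      rw [← hy.2, Fin.snoc_init_self]
      exact hy.1
    · intro v hv
      simpa using hv
    · rintro y hy
      rw [← (mem_filter.1 hy).2, Fin.snoc_init_self]
    · simp
  have hupper : (#M : ℝ) ≤ #M' * Fintype.card V +
      Fintype.card V ^ k * (δ * Fintype.card V) := by
    rw [hcount]
    calc _ ≤ ∑ x : Fin k → V, ((if x ∈ M' then (Fintype.card V : ℝ) else 0)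
            + δ * Fintype.card V) := by
          refine Finset.sum_le_sum fun x _ => ?_
          split_ifs with hx
          · have h1 : Nat.card {v // (Fin.snoc x v : Fin (k + 1) → V) ∈ M} ≤ Fintype.card V := by
              rw [Nat.card_eq_fintype_card]
              exact Fintype.card_subtype_le _
            have h2 : (Nat.card {v // (Fin.snoc x v : Fin (k + 1) → V) ∈ M} : ℝ)
                ≤ Fintype.card V := by exact_mod_cast h1
            have : 0 ≤ δ * Fintype.card V := by positivity
            linarith
          · rw [hM', not_le] at hx
            linarith
      _ = _ := by simp [Finset.sum_add_distrib]
  refine lt_of_mul_lt_mul_right ?_ hn.le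
  push_cast at hM
  have : (k : ℝ) * δ * Fintype.card V ^ k * Fintype.card V =
    (k + 1) * δ * Fintype.card V ^ (k + 1) - Fintype.card V ^ k * (δ * Fintype.card V) := by ring
  linarith

open Finset in
/-- One extension step: long cross-related families inside dense sets of `k`-tuples give
cross-related families of prefixes of a dense set of `(k + 1)`-tuples with many common
extensions. -/
theorem exists_crossRelated_common_extensions {V : Type*} [Fintype V] [Nonempty V] {k m s : ℕ}
    {δ : ℝ} (hδ : 0 < δ) (hm : 0 < m) (hs : (s : ℝ) ≤ δ * m / 2)
    (R : Fin (k + 1) → Fin (k + 1) → V → V → Prop)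
    (ih : ∀ M' : Finset (Fin k → V),
      (∀ x ∈ M', ∀ j j' : Fin k, j ≠ j' → R j.castSucc j'.castSucc (x j) (x j')) →
      (k : ℝ) * δ * Fintype.card V ^ k < #M' →
      ∃ x : Fin m → Fin k → V, (∀ i, x i ∈ M') ∧
        CrossRelated (fun j j' => R j.castSucc j'.castSucc) x)
    (M : Finset (Fin (k + 1) → V))
    (hR : ∀ x ∈ M, ∀ j j', j ≠ j' → R j j' (x j) (x j'))
    (hM : ((k + 1 : ℕ) : ℝ) * δ * Fintype.card V ^ (k + 1) < #M) :
    ∃ (x : Fin s → Fin k → V) (T : Finset V),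
      CrossRelated (fun j j' => R j.castSucc j'.castSucc) x ∧
      (∀ i, ∀ v ∈ T, (Fin.snoc (x i) v : Fin (k + 1) → V) ∈ M) ∧
      δ / 2 * Fintype.card V ≤ 2 ^ m * (#T : ℝ) := by
  classical
  have hn : (0 : ℝ) < Fintype.card V := by exact_mod_cast Fintype.card_pos
  let M' : Finset (Fin k → V) := {x |
    δ * Fintype.card V ≤ (Nat.card {v // (Fin.snoc x v : Fin (k + 1) → V) ∈ M} : ℝ)}
  have hM' : ∀ x, x ∈ M' ↔
      δ * Fintype.card V ≤ (Nat.card {v // (Fin.snoc x v : Fin (k + 1) → V) ∈ M} : ℝ) := by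
    simp [M']
  obtain ⟨x, hxM, hx⟩ := ih M' (fun x hx j j' hj => by
    have h1 := lt_of_lt_of_le (mul_pos hδ hn) ((hM' x).1 hx)
    have h2 : 0 < Nat.card {v // (Fin.snoc x v : Fin (k + 1) → V) ∈ M} := by exact_mod_cast h1
    obtain ⟨⟨v, hv⟩⟩ := (Nat.card_pos_iff.1 h2).1
    simpa using hR _ hv j.castSucc j'.castSucc (by simpa using hj))
    (card_prefixes_with_many_extensions hδ.le M M' hM' hM)
  obtain ⟨f, T, hT, hcard⟩ := exists_rows_with_many_common_neighbours
    (fun i v => (Fin.snoc (x i) v : Fin (k + 1) → V) ∈ M) hδ hm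
    (fun i => (hM' _).1 (hxM i)) hs
  exact ⟨fun i => x (f i), T, ⟨fun j => (hx.1 j).comp f.injective,
    fun i i' j j' hj => hx.2 _ _ _ _ hj⟩, hT, hcard⟩

open Finset in
/-- A dense set of `(k + 1)`-tuples contains a cross-related family of `s` members. -/
theorem exists_crossRelated_of_dense {V : Type*} [Fintype V] [Nonempty V] {r B : ℕ} {δ : ℝ}
    (hδ : 0 < δ) (hr : 2 / δ ≤ r)
    (hB : (2 : ℝ) ^ B * B ≤ δ / 2 * Fintype.card V) (k s : ℕ) (hs : 0 < s) (hsB : s * r ^ k ≤ B)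
    (R : Fin (k + 1) → Fin (k + 1) → V → V → Prop) (M : Finset (Fin (k + 1) → V))
    (hR : ∀ x ∈ M, ∀ j j', j ≠ j' → R j j' (x j) (x j'))
    (hM : ((k + 1 : ℕ) : ℝ) * δ * Fintype.card V ^ (k + 1) < #M) :
    ∃ x : Fin s → Fin (k + 1) → V, (∀ i, x i ∈ M) ∧ CrossRelated R x := by
  have hn : (0 : ℝ) < Fintype.card V := by exact_mod_cast Fintype.card_pos
  have hr' : 0 < r := by
    have : (0 : ℝ) < r := lt_of_lt_of_le (by positivity) hr
    exact_mod_cast this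
  induction k generalizing s with
  | zero =>
    have hsub : ∀ l l' : Fin (0 + 1), l = l' := fun l l' => by omega
    have hsM : s ≤ #M := by
      have h1 : (s : ℝ) ≤ B := by exact_mod_cast (by simpa using hsB)
      have h2 : (B : ℝ) ≤ 2 ^ B * B := le_mul_of_one_le_left (by positivity) (one_le_pow₀ (by norm_num))
      have h3 : (s : ℝ) ≤ #M := by
        have h4 : 0 < δ * Fintype.card V := by positivity
        norm_num at hM
        linarith
      exact_mod_cast h3
    obtain ⟨g⟩ : Nonempty (Fin s ↪ M) :=
      Function.Embedding.nonempty_of_card_le (by simpa using hsM)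
    refine ⟨fun i => g i, fun i => (g i).2, fun j i i' hii => ?_, fun i i' j j' hj => ?_⟩
    · apply g.injective
      apply Subtype.ext
      funext l
      rw [hsub l j]
      exact hii
    · exact absurd (hsub j j') hj
  | succ k ih =>
    have hsr : s * r * r ^ k ≤ B := by rwa [mul_assoc, ← pow_succ']
    have hsr' : s * r ≤ B := le_trans (Nat.le_mul_of_pos_right _ (by positivity)) hsr
    have hs' : (s : ℝ) ≤ δ * (s * r : ℕ) / 2 := by
      rw [div_le_iff₀ hδ] at hr
      push_cast
      nlinarith [Nat.cast_nonneg (α := ℝ) s]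
    obtain ⟨x, T, hx, hT, hcard⟩ := exists_crossRelated_common_extensions hδ
      (Nat.mul_pos hs hr') hs' R
      (fun M' hR' hM' => ih (s * r) (Nat.mul_pos hs hr') hsr _ M' hR' hM') M hR hM
    have hsT : s ≤ #T := by
      have h1 : (s : ℝ) ≤ B := by
        exact_mod_cast le_trans (Nat.le_mul_of_pos_right _ hr') hsr'
      have h2 : (2 : ℝ) ^ (s * r) ≤ 2 ^ B := pow_le_pow_right₀ (by norm_num) hsr'
      have h3 : (2 : ℝ) ^ B * s ≤ 2 ^ B * #T :=
        calc (2 : ℝ) ^ B * s ≤ 2 ^ B * B := by gcongr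
          _ ≤ δ / 2 * Fintype.card V := hB
          _ ≤ 2 ^ (s * r) * #T := hcard
          _ ≤ 2 ^ B * #T := by gcongr
      exact_mod_cast le_of_mul_le_mul_left h3 (by positivity)
    obtain ⟨g⟩ : Nonempty (Fin s ↪ T) :=
      Function.Embedding.nonempty_of_card_le (by simpa using hsT)
    refine ⟨fun i => Fin.snoc (x i) (g i), fun i => hT i _ (g i).2, fun j => ?_, ?_⟩
    · induction j using Fin.lastCases with
      | last =>
        intro i i' hii
        simp only [Fin.snoc_last] at hii
        exact g.injective (Subtype.ext hii)
      | cast j =>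
        intro i i' hii
        simp only [Fin.snoc_castSucc] at hii
        exact hx.1 j hii
    · intro i i' j j'
      induction j using Fin.lastCases with
      | last =>
        induction j' using Fin.lastCases with
        | last => exact fun hj => absurd rfl hj
        | cast j' =>
          intro hj
          simpa using hR _ (hT i' _ (g i).2) _ _ hj
      | cast j =>
        induction j' using Fin.lastCases with
        | last =>
          intro hj
          simpa using hR _ (hT i _ (g i').2) _ _ hj
        | cast j' =>
          intro hj
          simpa using hx.2 i i' j j' (by simpa using hj)

open Finset in
/-- Large vertex sets that are pairwise disjoint and pairwise complete or anticomplete according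
to `H` contain an induced blowup of `H`. -/
theorem containsInducedType_of_finsets {h : ℕ} {V : Type*} {H : SimpleGraph (Fin h)}
    {G : SimpleGraph V} {p : Fin h → ℕ} (A : Fin h → Finset V) (hp : ∀ u, p u ≤ #(A u))
    (hA : ∀ u v, u ≠ v → ∀ a ∈ A u, ∀ b ∈ A v, a ≠ b ∧ (G.Adj a b ↔ H.Adj u v)) :
    ContainsInducedType H p G := by
  have hf : ∀ u, Nonempty (Fin (p u) ↪ A u) := fun u =>
    Function.Embedding.nonempty_of_card_le (by simpa using hp u)
  let f u := (hf u).some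
  let φ : (Σ u : Fin h, Fin (p u)) → V := fun a => f a.1 a.2
  have hφ : Function.Injective φ := by
    rintro ⟨u, a⟩ ⟨v, b⟩ hab
    by_cases huv : u = v
    · subst huv
      have : a = b := (f u).injective (Subtype.ext hab)
      rw [this]
    · exact absurd hab (hA u v huv _ (f u a).2 _ (f v b).2).1
  exact ⟨G.comap φ, fun u v a b huv => (hA u v huv _ (f u a).2 _ (f v b).2).2,
    ⟨⟨⟨φ, hφ⟩, Iff.rfl⟩⟩⟩

open Finset in
/-- A graph with many induced copies of `H` contains an induced blowup of `H`; quantitative form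
with free parameters. -/
theorem exists_containsInducedType_of_card {V : Type*} [Fintype V] [Nonempty V] {k r s : ℕ}
    {δ : ℝ} (hδ : 0 < δ) (hr : 2 / δ ≤ r) (hs : 0 < s)
    (hB : (2 : ℝ) ^ (s * r ^ (k + 1)) * (s * r ^ (k + 1) : ℕ) ≤ δ / 2 * Fintype.card V)
    (H : SimpleGraph (Fin (k + 2))) (G : SimpleGraph V)
    (hG : ((k + 2 : ℕ) : ℝ) * δ * Fintype.card V ^ (k + 2) < Nat.card (H ↪g G)) :
    ∃ t : ℕ, δ / 2 * Fintype.card V ≤ 2 ^ (s * r ^ (k + 1)) * (t : ℝ) ∧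
      ContainsInducedType H (fun u => if (u : ℕ) < k + 1 then s else t) G := by
  classical
  have hr' : 0 < r := by
    have : (0 : ℝ) < r := lt_of_lt_of_le (by positivity) hr
    exact_mod_cast this
  let R : Fin (k + 2) → Fin (k + 2) → V → V → Prop :=
    fun j j' a b => a ≠ b ∧ (G.Adj a b ↔ H.Adj j j')
  let M : Finset (Fin (k + 2) → V) := {x | ∀ j j', j ≠ j' → R j j' (x j) (x j')}
  have hM : Nat.card (H ↪g G) ≤ #M := by
    let e : (H ↪g G) → M := fun f => ⟨f, by
      simp only [M, R, mem_filter, mem_univ, true_and]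
      exact fun j j' hj => ⟨f.injective.ne hj, f.map_adj_iff⟩⟩
    have he : Function.Injective e := fun f g hfg =>
      DFunLike.coe_injective (congrArg Subtype.val hfg)
    simpa using Nat.card_le_card_of_injective e he
  have hs' : (s : ℝ) ≤ δ * (s * r : ℕ) / 2 := by
    rw [div_le_iff₀ hδ] at hr
    push_cast
    nlinarith [Nat.cast_nonneg (α := ℝ) s]
  obtain ⟨x, T, hx, hT, hcard⟩ := exists_crossRelated_common_extensions hδ
    (Nat.mul_pos hs hr') hs' R
    (fun M' hR' hM' => exists_crossRelated_of_dense hδ hr hB k (s * r) (Nat.mul_pos hs hr')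
      (by rw [mul_assoc, ← pow_succ']) _ M' hR' hM') M (by simp [M])
    (lt_of_lt_of_le hG (by exact_mod_cast hM))
  refine ⟨#T, hcard.trans ?_, ?_⟩
  · have : s * r ≤ s * r ^ (k + 1) := Nat.mul_le_mul_left _ (Nat.le_self_pow (by simp) r)
    gcongr
    norm_num
  · refine containsInducedType_of_finsets
      (Fin.snoc (fun j => univ.image fun i => x i j) T : Fin (k + 2) → Finset V) ?_ ?_
    · intro u
      induction u using Fin.lastCases with
      | last => simp
      | cast j =>
        have hj : (j : ℕ) ≤ k := by omega
        simp [Finset.card_image_of_injective _ (hx.1 j), hj]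
    · have hR : ∀ i, ∀ v ∈ T, ∀ j j', j ≠ j' →
          R j j' ((Fin.snoc (x i) v : Fin (k + 2) → V) j)
            ((Fin.snoc (x i) v : Fin (k + 2) → V) j') := fun i v hv => by
        simpa [M] using hT i v hv
      intro u v
      induction u using Fin.lastCases with
      | last =>
        induction v using Fin.lastCases with
        | last => exact fun huv => absurd rfl huv
        | cast v =>
          intro huv a ha b hb
          simp only [Fin.snoc_last, Fin.snoc_castSucc, mem_image, mem_univ, true_and] at ha hb
          obtain ⟨i, rfl⟩ := hb
          simpa using hR i a ha _ _ huv
      | cast u =>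
        induction v using Fin.lastCases with
        | last =>
          intro huv a ha b hb
          simp only [Fin.snoc_last, Fin.snoc_castSucc, mem_image, mem_univ, true_and] at ha hb
          obtain ⟨i, rfl⟩ := ha
          simpa using hR i b hb _ _ huv
        | cast v =>
          intro huv a ha b hb
          simp only [Fin.snoc_castSucc, mem_image, mem_univ, true_and] at ha hb
          obtain ⟨i, rfl⟩ := ha
          obtain ⟨i', rfl⟩ := hb
          exact hx.2 i i' u v (by simpa using huv)

theorem eight_mul_le_four_pow {h : ℕ} (hh : 2 ≤ h) : 8 * h ≤ 4 ^ h := by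
  induction h, hh using Nat.le_induction with
  | base => norm_num
  | succ h hh ih => rw [pow_succ]; omega

/-- The first-order inequalities behind the choice of parameters. -/
theorem parameter_inequalities {k r s : ℕ} {c L : ℝ} (hk : 1 ≤ k) (hc : 0 < c) (hc4 : c ≤ 1 / 4)
    (hL : 1 ≤ c ^ ((k + 1) ^ 2) * L) (hr : (r : ℝ) ≤ 2 * (k + 1) / c + 1)
    (hs : (s : ℝ) ≤ c ^ ((k + 1) ^ 2) * L) :
    2 * ((s * r ^ k : ℕ) : ℝ) + 2 * (k + 1) / c ≤ c ^ k * L := by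
  have hLpos : 0 < L := by
    by_contra! hL0
    have : c ^ ((k + 1) ^ 2) * L ≤ 0 := mul_nonpos_of_nonneg_of_nonpos (by positivity) hL0
    linarith
  have hc1 : c ≤ 1 := by linarith
  have hpow4 : ∀ j : ℕ, c ^ j * 4 ^ j ≤ 1 := fun j => by
    rw [← mul_pow]
    exact pow_le_one₀ (by positivity) (by linarith)
  have hfirst : 2 * ((k : ℝ) + 1) / c ≤ 1 / 4 * (c ^ k * L) := by
    have h1 : (8 * ((k : ℝ) + 1)) ≤ 4 ^ (k + 1) := by
      exact_mod_cast eight_mul_le_four_pow (h := k + 1) (by omega)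
    have h2 : 1 ≤ c ^ (k + 1) * (c ^ (k + 1) * L) := by
      refine hL.trans ?_
      rw [← mul_assoc, ← pow_add]
      refine mul_le_mul_of_nonneg_right (pow_le_pow_of_le_one hc.le hc1 ?_) hLpos.le
      nlinarith
    have h3 : (4 : ℝ) ^ (k + 1) ≤ c ^ (k + 1) * L := by
      have h4 := hpow4 (k + 1)
      have h5 : 0 < c ^ (k + 1) := by positivity
      refine le_of_mul_le_mul_left (h4.trans h2) h5
    rw [div_le_iff₀ hc]
    rw [pow_succ c] at h3
    linarith
  have hratio : (r : ℝ) * c ≤ 2 * (k + 1) + 1 / 4 := by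
    have : (2 * ((k : ℝ) + 1) / c + 1) * c = 2 * (k + 1) + c := by field_simp
    nlinarith
  have hbase : c * (c ^ k * (r * c)) ^ k ≤ 3 / 8 := by
    rcases hk.eq_or_lt with rfl | hk2
    · norm_num at hratio ⊢
      have : c * (c * (r * c)) ≤ c * (c * (17 / 4)) := by gcongr
      nlinarith
    · have h1 : (8 * (k : ℝ)) ≤ 4 ^ k := by
        exact_mod_cast eight_mul_le_four_pow hk2
      have h2 : (2 : ℝ) ≤ k := by exact_mod_cast hk2
      have h3 : c ^ k * (r * c) ≤ 1 :=
        calc c ^ k * (r * c) ≤ c ^ k * 4 ^ k := by gcongr; linarith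
          _ ≤ 1 := hpow4 k
      have h4 : (c ^ k * (r * c)) ^ k ≤ 1 := pow_le_one₀ (by positivity) h3
      nlinarith
  have hsecond : ((s * r ^ k : ℕ) : ℝ) ≤ 3 / 8 * (c ^ k * L) :=
    calc ((s * r ^ k : ℕ) : ℝ) = s * r ^ k := by push_cast; rfl
      _ ≤ c ^ ((k + 1) ^ 2) * L * r ^ k := by gcongr
      _ = c * (c ^ k * (r * c)) ^ k * (c ^ k * L) := by
        rw [mul_pow, mul_pow, ← pow_mul]
        ring
      _ ≤ _ := by gcongr
  linarith

theorem four_pow_mul_lt_exp {m : ℕ} {a b : ℝ} (hab : 2 * (m : ℝ) + a ≤ b) :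
    4 ^ m * a < Real.exp b := by
  have h4 : (4 : ℝ) ≤ Real.exp 2 := by
    have h1 := Real.add_one_le_exp 1
    have h2 : Real.exp 2 = Real.exp 1 * Real.exp 1 := by rw [← Real.exp_add]; norm_num
    nlinarith
  calc (4 : ℝ) ^ m * a < 4 ^ m * Real.exp a :=
        mul_lt_mul_of_pos_left (by linarith [Real.add_one_le_exp a]) (by positivity)
    _ ≤ Real.exp 2 ^ m * Real.exp a := by gcongr
    _ = Real.exp (2 * m + a) := by rw [Real.exp_add, ← Real.exp_nat_mul, mul_comm (m : ℝ)]
    _ ≤ Real.exp b := Real.exp_le_exp.2 hab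

theorem stmt9 (h : ℕ) (H : SimpleGraph (Fin h)) (hh : 2 ≤ h) :
    ∃ N : ℕ, ∀ n ≥ N, h ≤ n → ∀ c : ℝ,
      (Real.log n) ^ (-(1/((h:ℝ)^2))) ≤ c → c ≤ 1/4 →
      ∀ G : SimpleGraph (Fin n),
        (c * (n:ℝ)^h < (Nat.card (H ↪g G) : ℝ)) →
        ∃ t : ℕ, (n:ℝ)^(1 - c^(h-1)) < (t:ℝ) ∧
          ContainsInducedType H
            (fun u => if (u:ℕ) < h - 1 then ⌊c^(h^2) * Real.log n⌋₊ else t) G := by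
  obtain ⟨k, rfl⟩ : ∃ k, h = k + 2 := ⟨h - 2, by omega⟩
  refine ⟨0, fun n _ hn c hc hc4 G hG => ?_⟩
  have hn2 : 2 ≤ n := by omega
  have hn1 : (1 : ℝ) < n := by exact_mod_cast hn2
  have hn0 : (0 : ℝ) < n := by linarith
  have : Nonempty (Fin n) := ⟨⟨0, by omega⟩⟩
  set L := Real.log n with hLdef
  have hL : 0 < L := Real.log_pos hn1
  have hcpos : 0 < c := lt_of_lt_of_le (Real.rpow_pos_of_pos hL _) hc
  have hcL : 1 ≤ c ^ ((k + 2) ^ 2) * L := by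
    have h1 : L⁻¹ ≤ c ^ ((k + 2) ^ 2) :=
      calc L⁻¹ = (L ^ (-(1 / (((k + 2 : ℕ) : ℝ) ^ 2)))) ^ ((k + 2) ^ 2) := by
            rw [← Real.rpow_natCast, ← Real.rpow_mul hL.le, ← Real.rpow_neg_one]
            congr 1
            push_cast
            field_simp
        _ ≤ _ := pow_le_pow_left₀ (Real.rpow_nonneg hL.le _) hc _
    calc (1 : ℝ) = L⁻¹ * L := (inv_mul_cancel₀ hL.ne').symm
      _ ≤ _ := by gcongr
  set s := ⌊c ^ ((k + 2) ^ 2) * L⌋₊ with hsdef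
  have hs : 0 < s := Nat.floor_pos.2 hcL
  set r := ⌈2 * (((k + 1 : ℕ) : ℝ) + 1) / c⌉₊ with hrdef
  set m := s * r ^ (k + 1) with hmdef
  have hbig : 4 ^ m * (2 * (((k + 1 : ℕ) : ℝ) + 1) / c) < (n : ℝ) ^ (c ^ (k + 1)) := by
    rw [Real.rpow_def_of_pos hn0, ← hLdef, mul_comm L]
    exact four_pow_mul_lt_exp (parameter_inequalities (by omega) hcpos hc4 hcL
      (Nat.ceil_lt_add_one (by positivity)).le (Nat.floor_le (by positivity)))
  have hδ : 0 < c / ((k + 2 : ℕ) : ℝ) := by positivity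
  have hδ_inv : 2 * (((k + 1 : ℕ) : ℝ) + 1) / c * (c / ((k + 2 : ℕ) : ℝ) / 2) = 1 := by
    push_cast
    field_simp
    ring
  have hr : 2 / (c / ((k + 2 : ℕ) : ℝ)) ≤ r := by
    refine le_trans (le_of_eq ?_) (Nat.le_ceil _)
    push_cast
    field_simp
    ring
  have hbig' : 4 ^ m < c / ((k + 2 : ℕ) : ℝ) / 2 * (n : ℝ) ^ (c ^ (k + 1)) :=
    calc (4 : ℝ) ^ m = 4 ^ m * (2 * (((k + 1 : ℕ) : ℝ) + 1) / c) *
          (c / ((k + 2 : ℕ) : ℝ) / 2) := by rw [mul_assoc, hδ_inv, mul_one]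
      _ < (n : ℝ) ^ (c ^ (k + 1)) * (c / ((k + 2 : ℕ) : ℝ) / 2) := by gcongr
      _ = _ := mul_comm _ _
  have hpow : (4 : ℝ) ^ m = 2 ^ m * 2 ^ m := by rw [← mul_pow]; norm_num
  have hB : (2 : ℝ) ^ m * (m : ℕ) ≤ c / ((k + 2 : ℕ) : ℝ) / 2 * Fintype.card (Fin n) := by
    have h1 : (m : ℝ) ≤ 2 ^ m := by exact_mod_cast Nat.lt_two_pow_self.le
    have h2 : (n : ℝ) ^ (c ^ (k + 1)) ≤ n := by
      conv_rhs => rw [← Real.rpow_one (n : ℝ)]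
      exact Real.rpow_le_rpow_of_exponent_le hn1.le (pow_le_one₀ hcpos.le (by linarith))
    rw [Fintype.card_fin]
    calc (2 : ℝ) ^ m * (m : ℕ) ≤ 2 ^ m * 2 ^ m := by gcongr
      _ = 4 ^ m := hpow.symm
      _ ≤ c / ((k + 2 : ℕ) : ℝ) / 2 * (n : ℝ) ^ (c ^ (k + 1)) := hbig'.le
      _ ≤ _ := by gcongr
  obtain ⟨t, ht, hblow⟩ := exists_containsInducedType_of_card hδ hr hs hB H G (by
    rw [Fintype.card_fin, mul_div_cancel₀ c (by positivity)]
    exact hG)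
  refine ⟨t, ?_, hblow⟩
  rw [Fintype.card_fin] at ht
  change (n : ℝ) ^ (1 - c ^ (k + 1)) < t
  have hX : 0 < (n : ℝ) ^ (c ^ (k + 1)) := Real.rpow_pos_of_pos hn0 _
  rw [Real.rpow_sub hn0, Real.rpow_one, div_lt_iff₀ hX]
  have h1 : (2 : ℝ) ^ m ≤ 4 ^ m := by gcongr; norm_num
  have h2 : (2 : ℝ) ^ m * n < 2 ^ m * (t * (n : ℝ) ^ (c ^ (k + 1))) :=
    calc (2 : ℝ) ^ m * n ≤ 4 ^ m * n := by gcongr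
      _ < c / ((k + 2 : ℕ) : ℝ) / 2 * (n : ℝ) ^ (c ^ (k + 1)) * n := by gcongr
      _ = c / ((k + 2 : ℕ) : ℝ) / 2 * n * (n : ℝ) ^ (c ^ (k + 1)) := by ring
      _ ≤ 2 ^ m * t * (n : ℝ) ^ (c ^ (k + 1)) := by gcongr
      _ = _ := by ring
  exact lt_of_mul_lt_mul_left h2 (by positivity)
end
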